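/- arXiv:2104.01187 — 2 statements merged into one kernel-verified Lean document; each statement's English description precedes it below -/
import Mathlib

section
/- Set r = ab+1. There exist rational functions h_{−r},…,h_r (each a quotient of two real polynomials, the denominator not identically zero) and real numbers γ_0,…,γ_{N+b}, not all equal, such that for every n with 0 ≤ n ≤ N+b and every real x at which none of the denominators of h_{−r},…,h_r vanishes, Σ_{j=−r}^{r} h_j(x)·q_n^{a,b,N;M}(λ^{a,b}(x+j)) = γ_n·q_n^{a,b,N;M}(λ^{a,b}(x)); that is, the functions q_n^{a,b,N;M}(λ^{a,b}(x)) are common eigenfunctions of a difference operator of the form Σ_{j=−r}^{r} h_j·S_j^λ with rational coefficients, where S_j^λ(p(λ^{a,b}(x))) = p(λ^{a,b}(x+j)). -/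
noncomputable section

open Finset

/-- Pochhammer symbol `(x)_m = x (x+1) ⋯ (x+m-1)`. -/
def poch (x : ℝ) (m : ℕ) : ℝ := ∏ i ∈ Finset.range m, (x + i)

/-- Complex Pochhammer symbol. -/
def pochC (x : ℂ) (m : ℕ) : ℂ := ∏ i ∈ Finset.range m, (x + i)

/-- `λ^{a,b}(x) = x (x + a + b + 1)`. -/
def lam (a b : ℕ) (x : ℝ) : ℝ := x * (x + a + b + 1)

/-- Complex version of `λ^{a,b}`. -/
def lamC (a b : ℕ) (x : ℂ) : ℂ := x * (x + a + b + 1)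

/-- Hahn polynomial `h_n^{α,β,ν}(x)`. -/
def hahn (α β ν : ℝ) (n : ℕ) (x : ℝ) : ℝ :=
  ∑ j ∈ Finset.range (n + 1),
    poch (-(n : ℝ)) j * poch (α + β + n + 1) j * poch (-ν + j) (n - j) *
      poch (α + j + 1) (n - j) * poch (-x) j / (Nat.factorial j : ℝ)

/-- Dual Hahn polynomial `R_n^{α,β,ν}(x)` for `n : ℕ`. -/
def dualHahnNat (α β ν : ℝ) (n : ℕ) (x : ℝ) : ℝ :=
  ∑ j ∈ Finset.range (n + 1),
    poch (-(n : ℝ)) j * poch (-ν + j) (n - j) * poch (α + j + 1) (n - j) /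
        ((Nat.factorial n : ℝ) * (-1) ^ j * (Nat.factorial j : ℝ)) *
      ∏ i ∈ Finset.range j, (x - i * (α + β + 1 + i))

/-- Dual Hahn polynomial with the convention `R_k ≡ 0` for `k < 0`. -/
def dualHahn (α β ν : ℝ) (k : ℤ) (x : ℝ) : ℝ :=
  if k < 0 then 0 else dualHahnNat α β ν k.toNat x

/-- Complex dual Hahn polynomial. -/
def dualHahnNatC (α β ν : ℂ) (n : ℕ) (x : ℂ) : ℂ :=
  ∑ j ∈ Finset.range (n + 1),
    pochC (-(n : ℂ)) j * pochC (-ν + j) (n - j) * pochC (α + j + 1) (n - j) /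
        ((Nat.factorial n : ℂ) * (-1) ^ j * (Nat.factorial j : ℂ)) *
      ∏ i ∈ Finset.range j, (x - i * (α + β + 1 + i))

/-- Complex dual Hahn polynomial with the convention `R_k ≡ 0` for `k < 0`. -/
def dualHahnC (α β ν : ℂ) (k : ℤ) (x : ℂ) : ℂ :=
  if k < 0 then 0 else dualHahnNatC α β ν k.toNat x

/-- `⌈(a+b)/2⌉`. -/
def ceilHalf (a b : ℕ) : ℕ := (a + b + 1) / 2

/-- The auxiliary polynomials `W_g^{a,b,N;𝓜}(x)`; the third parameter is allowed to be any
real number (so that triples like `(a, b, -2-N-a-b)` can be used). -/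
def W (a b : ℕ) (Nr : ℝ) (M : ℕ → ℝ) (g : ℕ) (x : ℝ) : ℝ :=
  if a ≤ g ∧ g ≤ a + b - 1 then
    (-1 : ℝ) ^ (b + g) * (Nat.factorial (g - b) : ℝ) *
      ((Nat.factorial (a + b - g - 1) : ℝ) * poch (-x) a *
          hahn (a : ℝ) (-(b : ℝ)) (-2 - Nr - a) (g - a) (x - a) +
        (Nat.factorial (g - a) : ℝ) * poch (Nr + a + b + 1 - g) (2 * g - a - b + 1) / M (g - a) *
          hahn (-(a : ℝ)) (-(b : ℝ)) (-2 - Nr) (a + b - g - 1) x)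
  else if ceilHalf a b ≤ g ∧ g + 1 ≤ a then
    deriv (fun s : ℝ =>
      hahn (-(a : ℝ) - s) (-(b : ℝ)) (-2 - Nr) g x -
        hahn (-(a : ℝ) - s) (-(b : ℝ)) (-2 - Nr) g 0 /
            hahn (-(a : ℝ) - s) (-(b : ℝ)) (-2 - Nr) (a + b - g - 1) 0 *
          hahn (-(a : ℝ) - s) (-(b : ℝ)) (-2 - Nr) (a + b - g - 1) x) 0
  else hahn (-(a : ℝ)) (-(b : ℝ)) (-2 - Nr) g x

/-- The mass `ρ_{b,a,N}(x)` of the dual Hahn measure. -/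
def rhoDH (a b N : ℕ) (x : ℕ) : ℝ :=
  (2 * (x : ℝ) + a + b + 1) * poch ((b : ℝ) + 1) x * poch (-(N : ℝ)) x * (Nat.factorial N : ℝ) /
    ((-1 : ℝ) ^ x * poch ((x : ℝ) + a + b + 1) (N + 1) * poch ((a : ℝ) + 1) x *
      (Nat.factorial x : ℝ))

/-- The mass of the measure `ν_{a,b,N}^{𝓜}` at the point `λ^{a,b}(x)`, for `x = -b, …, N`. -/
def mass (a b N : ℕ) (M : ℕ → ℝ) (x : ℤ) : ℝ :=
  if x < 0 then
    (2 * (x : ℝ) + a + b + 1) * poch ((N : ℝ) + 1 - (x : ℝ)) (x + b).toNat /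
        poch ((N : ℝ) + b + 1) (x + a + 1).toNat * M (x + b).toNat
  else
    (poch ((N : ℝ) + 1) b) ^ 2 / poch ((b : ℝ) + 1) (a - b) * rhoDH a b N x.toNat /
      ∏ i ∈ Finset.range b, (((x : ℝ) + a + i + 1) * ((x : ℝ) + b - i))

/-- The pairing `⟨p, q⟩` with respect to `ν_{a,b,N}^{𝓜}`. -/
def pairing (a b N : ℕ) (M : ℕ → ℝ) (p q : ℝ → ℝ) : ℝ :=
  ∑ x ∈ Finset.Icc (-(b : ℤ)) (N : ℤ),
    mass a b N M x * p (lam a b (x : ℝ)) * q (lam a b (x : ℝ))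

/-- The determinant `Φ_n^{a,b,N;𝓜}`. -/
def PhiM (a b N : ℕ) (M : ℕ → ℝ) (n : ℕ) : ℝ :=
  Matrix.det (Matrix.of fun i j : Fin a =>
    W a b (N : ℝ) M (b + (i : ℕ)) (-(n : ℝ) + ((j : ℕ) : ℝ)))

/-- The polynomial `q_n^{a,b,N;𝓜}(x)` given by the determinantal formula. -/
def qM (a b N : ℕ) (M : ℕ → ℝ) (n : ℕ) (x : ℝ) : ℝ :=
  Matrix.det (Matrix.of fun i j : Fin (a + 1) =>
    if (i : ℕ) = 0 then
      (-1 : ℝ) ^ (j : ℕ) * dualHahn (a : ℝ) (b : ℝ) (N : ℝ) ((n : ℤ) - ((j : ℕ) : ℤ)) x /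
        poch ((b : ℝ) + N - n + (j : ℕ) + 1) (a - (j : ℕ))
    else
      W a b (N : ℝ) M (b + (i : ℕ) - 1) (-(n : ℝ) + ((j : ℕ) : ℝ) - 1))

open Polynomial in
/-- `G` is obtained from `F`, simultaneously for all indices `n ≤ n₀`, by one difference operator
in `x` with rational coefficients and shifts between `-r` and `r`. -/
def ShiftRel (n₀ r : ℕ) (F G : ℕ → ℝ → ℝ) : Prop :=
  ∃ (d : ℝ[X]) (c : ℤ → ℝ[X]), d ≠ 0 ∧ ∀ n ≤ n₀, ∀ x : ℝ,
    d.eval x * G n x = ∑ j ∈ Icc (-(r : ℤ)) r, (c j).eval x * F n (x + j)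

namespace ShiftRel

open Polynomial

variable {n₀ r r₁ r₂ : ℕ} {F G H : ℕ → ℝ → ℝ}

theorem mono (h : ShiftRel n₀ r₁ F G) (hr : r₁ ≤ r₂) : ShiftRel n₀ r₂ F G := by
  obtain ⟨d, c, hd, h⟩ := h
  refine ⟨d, fun j => if j ∈ Icc (-(r₁ : ℤ)) r₁ then c j else 0, hd, fun n hn x => ?_⟩
  rw [h n hn x]
  have hs : Icc (-(r₁ : ℤ)) r₁ ⊆ Icc (-(r₂ : ℤ)) r₂ := Icc_subset_Icc (by omega) (by omega)
  rw [← Finset.sum_subset hs]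
  · exact Finset.sum_congr rfl fun j hj => by simp only [hj, if_true]
  · intro j _ hj
    simp only [hj, if_false, eval_zero, zero_mul]

theorem refl (F : ℕ → ℝ → ℝ) : ShiftRel n₀ 0 F F :=
  ⟨1, fun _ => 1, one_ne_zero, fun n _ x => by simp⟩

theorem zero (F : ℕ → ℝ → ℝ) : ShiftRel n₀ r F (fun _ _ => 0) :=
  ⟨1, fun _ => 0, one_ne_zero, fun n _ x => by simp⟩

theorem add (h₁ : ShiftRel n₀ r F G) (h₂ : ShiftRel n₀ r F H) :
    ShiftRel n₀ r F (fun n x => G n x + H n x) := by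
  obtain ⟨d₁, c₁, hd₁, h₁⟩ := h₁
  obtain ⟨d₂, c₂, hd₂, h₂⟩ := h₂
  refine ⟨d₁ * d₂, fun j => d₂ * c₁ j + d₁ * c₂ j, mul_ne_zero hd₁ hd₂, fun n hn x => ?_⟩
  have e : (d₁ * d₂).eval x * (G n x + H n x) =
      d₂.eval x * (d₁.eval x * G n x) + d₁.eval x * (d₂.eval x * H n x) := by
    rw [eval_mul]; ring
  rw [e, h₁ n hn x, h₂ n hn x, mul_sum, mul_sum, ← sum_add_distrib]
  refine sum_congr rfl fun j _ => ?_
  simp only [eval_add, eval_mul]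
  ring

theorem smul (a : ℝ) (h : ShiftRel n₀ r F G) : ShiftRel n₀ r F (fun n x => a * G n x) := by
  obtain ⟨d, c, hd, h⟩ := h
  refine ⟨d, fun j => C a * c j, hd, fun n hn x => ?_⟩
  rw [mul_left_comm, h n hn x, mul_sum]
  refine sum_congr rfl fun j _ => ?_
  simp only [eval_mul, eval_C]
  ring

/-- Difference operators in `x` commute with linear operations on the index. -/
theorem comb (h : ShiftRel n₀ r F G) (s : ℕ → Finset ℕ) (w : ℕ → ℕ → ℝ)
    (hs : ∀ n, ∀ k ∈ s n, k ≤ n) :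
    ShiftRel n₀ r (fun n x => ∑ k ∈ s n, w n k * F k x) (fun n x => ∑ k ∈ s n, w n k * G k x) := by
  obtain ⟨d, c, hd, h⟩ := h
  refine ⟨d, c, hd, fun n hn x => ?_⟩
  simp only [mul_sum]
  rw [sum_comm]
  refine sum_congr rfl fun k hk => ?_
  rw [mul_left_comm, h k ((hs n k hk).trans hn) x, mul_sum]
  refine sum_congr rfl fun j _ => ?_
  ring

theorem mul_left (h : ShiftRel n₀ r F G) (φ : ℕ → ℝ) :
    ShiftRel n₀ r (fun n x => φ n * F n x) (fun n x => φ n * G n x) := by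
  simpa using h.comb (fun n => {n}) (fun n _ => φ n) (by simp)

theorem partialSum (h : ShiftRel n₀ r F G) :
    ShiftRel n₀ r (fun n x => ∑ k ∈ range (n + 1), F k x)
      (fun n x => ∑ k ∈ range (n + 1), G k x) := by
  simpa using h.comb (fun n => range (n + 1)) (fun _ _ => 1)
    (fun n k hk => Nat.lt_succ_iff.1 (mem_range.1 hk))

theorem trans (h₁ : ShiftRel n₀ r₁ F G) (h₂ : ShiftRel n₀ r₂ G H) :
    ShiftRel n₀ (r₁ + r₂) F H := by
  obtain ⟨d₁, c₁, hd₁, h₁⟩ := h₁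
  obtain ⟨d₂, c₂, hd₂, h₂⟩ := h₂
  set I₁ := Icc (-(r₁ : ℤ)) r₁ with hI₁
  set I₂ := Icc (-(r₂ : ℤ)) r₂ with hI₂
  let σ : ℤ → ℝ[X] → ℝ[X] := fun j p => p.comp (X + C (j : ℝ))
  have hσ : ∀ j p x, (σ j p).eval x = p.eval (x + j) := fun j p x => by simp [σ]
  have hσ0 : ∀ j, σ j d₁ ≠ 0 := fun j => by
    simpa [σ] using (comp_X_add_C_ne_zero_iff (p := d₁) (t := (j : ℝ))).2 hd₁
  refine ⟨d₂ * ∏ j ∈ I₂, σ j d₁,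
    fun i => ∑ j ∈ I₂, ∑ k ∈ I₁, if j + k = i then
      c₂ j * (∏ j' ∈ I₂.erase j, σ j' d₁) * σ j (c₁ k) else 0,
    mul_ne_zero hd₂ (prod_ne_zero_iff.2 fun j _ => hσ0 j), fun n hn x => ?_⟩
  have e : (d₂ * ∏ j ∈ I₂, σ j d₁).eval x * H n x =
      (∏ j ∈ I₂, d₁.eval (x + j)) * (d₂.eval x * H n x) := by
    rw [eval_mul, eval_prod]; simp only [hσ]; ring
  rw [e, h₂ n hn x, mul_sum]
  simp only [eval_finsetSum, sum_mul]
  rw [sum_comm]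
  refine sum_congr rfl fun j hj => ?_
  rw [sum_comm, ← mul_prod_erase I₂ (fun j : ℤ => d₁.eval (x + j)) hj]
  have e2 : d₁.eval (x + j) * (∏ j' ∈ I₂.erase j, d₁.eval (x + j')) *
      ((c₂ j).eval x * G n (x + j)) =
      (∏ j' ∈ I₂.erase j, d₁.eval (x + j')) * (c₂ j).eval x *
        (d₁.eval (x + j) * G n (x + j)) := by ring
  rw [e2, h₁ n hn (x + j), mul_sum]
  refine sum_congr rfl fun k hk => ?_
  rw [sum_eq_single (j + k)]
  · simp only [if_true, eval_mul, eval_prod, hσ]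
    push_cast
    rw [add_assoc x]
    ring
  · intro i _ hi
    rw [if_neg (Ne.symm hi), eval_zero, zero_mul]
  · intro hi
    rw [hI₂, mem_Icc] at hj
    rw [hI₁, mem_Icc] at hk
    exact absurd (mem_Icc.2 ⟨by push_cast; omega, by push_cast; omega⟩) hi

theorem pow (h : ShiftRel n₀ 1 F (fun n x => (n : ℝ) * F n x)) (i : ℕ) :
    ShiftRel n₀ i F (fun n x => (n : ℝ) ^ i * F n x) := by
  induction i with
  | zero => simpa using refl F
  | succ i ih =>
    have := ih.trans (h.mul_left (fun n => (n : ℝ) ^ i))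
    simpa only [pow_succ, mul_assoc] using this

theorem sum {ι : Type*} (s : Finset ι) (G : ι → ℕ → ℝ → ℝ)
    (h : ∀ i ∈ s, ShiftRel n₀ r F (G i)) : ShiftRel n₀ r F (fun n x => ∑ i ∈ s, G i n x) := by
  classical
  induction s using Finset.induction_on with
  | empty => simpa using zero F
  | insert i s hi ih =>
    simp only [sum_insert hi]
    exact (h i (mem_insert_self i s)).add (ih fun j hj => h j (mem_insert_of_mem hj))

theorem polynomial (h : ShiftRel n₀ 1 F (fun n x => (n : ℝ) * F n x)) (p : ℝ[X]) :
    ShiftRel n₀ p.natDegree F (fun n x => p.eval (n : ℝ) * F n x) := by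
  have : ShiftRel n₀ p.natDegree F
      (fun n x => ∑ i ∈ range (p.natDegree + 1), p.coeff i * ((n : ℝ) ^ i * F n x)) :=
    sum _ _ fun i hi => ((h.pow i).mono (Nat.lt_succ_iff.1 (mem_range.1 hi))).smul _
  convert this using 3 with n x
  rw [eval_eq_sum_range, sum_mul]
  exact sum_congr rfl fun i _ => by ring

theorem kernel (h : ShiftRel n₀ 1 F (fun n x => (n : ℝ) * F n x))
    (hS : ShiftRel n₀ 1 F (fun n x => ∑ k ∈ range (n + 1), F k x)) (p q : ℝ[X]) :
    ShiftRel n₀ (p.natDegree + q.natDegree + 1) F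
      (fun (n : ℕ) x => ∑ k ∈ range (n + 1), p.eval (n : ℝ) * q.eval (k : ℝ) * F k x) := by
  have h₁ := (h.polynomial p).trans
    ((hS.trans (h.polynomial q).partialSum).mul_left (fun n => p.eval (n : ℝ)))
  have e : (fun (n : ℕ) x => ∑ k ∈ range (n + 1), p.eval (n : ℝ) * q.eval (k : ℝ) * F k x) =
      fun (n : ℕ) x => p.eval (n : ℝ) * ∑ k ∈ range (n + 1), q.eval (k : ℝ) * F k x := by
    funext n x
    rw [mul_sum]
    exact sum_congr rfl fun k _ => by ring
  rw [e]
  exact h₁.mono (by omega)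

end ShiftRel

section Differences

open Polynomial fwdDiff

/-- The forward difference `p(x + h) - p(x)` of a polynomial. -/
def polyDiff (h : ℝ) (p : ℝ[X]) : ℝ[X] := p.comp (X + C h) - p

theorem eval_polyDiff_iterate (h : ℝ) (p : ℝ[X]) (l : ℕ) (x : ℝ) :
    ((polyDiff h)^[l] p).eval x = ((fwdDiff h)^[l] fun y => p.eval y) x := by
  have key : ∀ q : ℝ[X], (fun y => (polyDiff h q).eval y) = fwdDiff h fun y => q.eval y := by
    intro q
    funext y
    simp [polyDiff, fwdDiff]
  induction l generalizing p with
  | zero => rfl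
  | succ l ih => rw [Function.iterate_succ_apply, ih, key, Function.iterate_succ_apply]

theorem polyDiff_eq_zero_or (h : ℝ) (p : ℝ[X]) :
    polyDiff h p = 0 ∨ (polyDiff h p).natDegree + 1 ≤ p.natDegree := by
  by_cases h0 : polyDiff h p = 0
  · exact Or.inl h0
  refine Or.inr (Nat.succ_le_of_lt ?_)
  have hp : p ≠ 0 := by
    rintro rfl
    simp [polyDiff] at h0
  have hX : (X + C h).natDegree = 1 := natDegree_X_add_C h
  have hd : (p.comp (X + C h)).natDegree = p.natDegree := by rw [natDegree_comp, hX, mul_one]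
  have hc : p.comp (X + C h) ≠ 0 := comp_X_add_C_ne_zero_iff.2 hp
  refine natDegree_lt_natDegree h0 ?_ |>.trans_le hd.le
  refine degree_sub_lt_left ?_ hc ?_
  · rw [degree_eq_natDegree hc, degree_eq_natDegree hp, hd]
  · rw [leadingCoeff_comp (by rw [hX]; exact one_ne_zero), leadingCoeff_X_add_C, one_pow, mul_one]

theorem polyDiff_iterate_eq_zero_or (h : ℝ) (p : ℝ[X]) (l : ℕ) :
    (polyDiff h)^[l] p = 0 ∨ ((polyDiff h)^[l] p).natDegree + l ≤ p.natDegree := by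
  induction l with
  | zero => right; simp
  | succ l ih =>
    rw [Function.iterate_succ_apply']
    rcases polyDiff_eq_zero_or h ((polyDiff h)^[l] p) with h1 | h1
    · exact Or.inl h1
    · rcases ih with h2 | h2
      · rw [h2, natDegree_zero] at h1
        omega
      · right; omega

/-- Every polynomial has an antidifference of degree one more. -/
theorem exists_antidifference (p : ℝ[X]) (d : ℕ) (hp : p.natDegree ≤ d) :
    ∃ P : ℝ[X], P.natDegree ≤ d + 1 ∧ ∀ x, P.eval (x + 1) - P.eval x = p.eval x := by
  let b : ℕ → ℝ[X] := fun k => (Polynomial.bernoulli k).map (algebraMap ℚ ℝ)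
  have hb : ∀ k, (b k).natDegree ≤ k := fun k => by
    refine natDegree_map_le.trans ?_
    rw [Polynomial.bernoulli]
    refine natDegree_sum_le_of_forall_le _ _ fun i _ => ?_
    exact (natDegree_monomial_le _).trans (by omega)
  have hbe : ∀ k x, (b (k + 1)).eval (x + 1) - (b (k + 1)).eval x = (k + 1) * x ^ k := by
    intro k x
    have h := congrArg (fun q => (q.map (algebraMap ℚ ℝ)).eval x)
      (Polynomial.bernoulli_comp_one_add_X (k + 1))
    simp only [Polynomial.map_comp, Polynomial.map_add, Polynomial.map_one, map_X, eval_comp,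
      eval_add, eval_one, eval_X, add_comm (1 : ℝ) x] at h
    rw [h, add_sub_cancel_left]
    simp
  refine ⟨∑ k ∈ range (d + 1), C (p.coeff k / (k + 1)) * b (k + 1), ?_, fun x => ?_⟩
  · refine natDegree_sum_le_of_forall_le _ _ fun k hk => ?_
    refine (natDegree_C_mul_le _ _).trans ((hb _).trans ?_)
    have := mem_range.1 hk
    omega
  · rw [eval_finsetSum, eval_finsetSum, ← sum_sub_distrib,
      eval_eq_sum_range' (Nat.lt_succ_of_le hp)]
    refine sum_congr rfl fun k _ => ?_
    rw [eval_mul, eval_mul, eval_C, eval_C, ← mul_sub, hbe]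
    have : (k : ℝ) + 1 ≠ 0 := by positivity
    field_simp

end Differences

section Casorati

open Polynomial fwdDiff Matrix

/-- Kernels `∑ p(y) q(z)` of total degree at most `d`. -/
def kernelSpace (d : ℕ) : Submodule ℝ (ℝ → ℝ → ℝ) :=
  Submodule.span ℝ {K | ∃ p q : ℝ[X], p.natDegree + q.natDegree ≤ d ∧
    K = fun y z => p.eval y * q.eval z}

variable {m : ℕ} (Y : Fin m → ℝ[X])

/-- The Casorati matrix of `Y` at the points `z, z - 1, …, z - m + 1`. -/
def casorati (z : ℝ) : Matrix (Fin m) (Fin m) ℝ :=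
  of fun i h => (Y h).eval (z - (i : ℕ))

/-- The matrix of iterated backward differences of `Y`. -/
def diffMatrix (z : ℝ) : Matrix (Fin m) (Fin m) ℝ :=
  of fun l h => ((polyDiff (-1))^[(l : ℕ)] (Y h)).eval z

/-- The lower unitriangular matrix of binomial coefficients. -/
def binomMatrix (m : ℕ) : Matrix (Fin m) (Fin m) ℝ :=
  of fun i l => (((i : ℕ).choose l : ℕ) : ℝ)

theorem sum_binomMatrix_mul (i : Fin m) (f : ℕ → ℝ) :
    ∑ l, binomMatrix m i l * f l = ∑ k ∈ range ((i : ℕ) + 1), ((i : ℕ).choose k : ℝ) * f k := by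
  rw [← Fin.sum_univ_eq_sum_range (fun k => ((i : ℕ).choose k : ℝ) * f k) (i + 1)]
  rw [Fin.sum_univ_eq_sum_range (fun k => ((i : ℕ).choose k : ℝ) * f k) (i + 1)]
  have : ∑ l, binomMatrix m i l * f l = ∑ k ∈ range m, ((i : ℕ).choose k : ℝ) * f k := by
    rw [← Fin.sum_univ_eq_sum_range (fun k => ((i : ℕ).choose k : ℝ) * f k) m]
    rfl
  rw [this]
  symm
  refine sum_subset (range_subset_range.2 i.2) fun k _ hk => ?_
  rw [mem_range, not_lt] at hk
  rw [Nat.choose_eq_zero_of_lt (by omega), Nat.cast_zero, zero_mul]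

theorem det_binomMatrix (m : ℕ) : (binomMatrix m).det = 1 := by
  rw [det_of_isLowerTriangular]
  · simp [binomMatrix]
  · intro i j hij
    have hij : (i : ℕ) < j := hij
    simp [binomMatrix, Nat.choose_eq_zero_of_lt hij]

theorem adjugate_binomMatrix_mul (m : ℕ) : (binomMatrix m).adjugate * binomMatrix m = 1 := by
  rw [adjugate_mul, det_binomMatrix, one_smul]

theorem casorati_eq (z : ℝ) : casorati Y z = binomMatrix m * diffMatrix Y z := by
  ext i h
  rw [mul_apply]
  have h1 := sum_binomMatrix_mul i (fun l => ((polyDiff (-1))^[l] (Y h)).eval z)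
  have h2 := shift_eq_sum_fwdDiff_iter (-1 : ℝ) (fun y => (Y h).eval y) (i : ℕ) z
  simp only [← eval_polyDiff_iterate, nsmul_eq_mul] at h2
  refine Eq.trans ?_ h1.symm
  rw [← h2]
  simp [casorati, sub_eq_add_neg]

theorem det_casorati (z : ℝ) : (casorati Y z).det = (diffMatrix Y z).det := by
  rw [casorati_eq, det_mul, det_binomMatrix, one_mul]

theorem sum_adjugate_binomMatrix (L : Fin m) (q : ℝ[X]) (z : ℝ) :
    ∑ s, (binomMatrix m).adjugate L s * q.eval (z + (s : ℕ)) =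
      ((polyDiff 1)^[(L : ℕ)] q).eval z := by
  have h : ∀ s : Fin m, q.eval (z + (s : ℕ)) =
      ∑ k, binomMatrix m s k * ((polyDiff 1)^[(k : ℕ)] q).eval z := by
    intro s
    have h1 := sum_binomMatrix_mul s (fun l => ((polyDiff 1)^[l] q).eval z)
    have h2 := shift_eq_sum_fwdDiff_iter (1 : ℝ) (fun y => q.eval y) (s : ℕ) z
    simp only [← eval_polyDiff_iterate, nsmul_eq_mul, mul_one] at h2
    rw [h1, ← h2]
  simp only [h, mul_sum]
  rw [sum_comm]
  simp only [← mul_assoc, ← sum_mul]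
  have h3 : ∀ k, ∑ s, (binomMatrix m).adjugate L s * binomMatrix m s k =
      (1 : Matrix (Fin m) (Fin m) ℝ) L k := fun k => by
    rw [← adjugate_binomMatrix_mul, mul_apply]
  simp [h3, one_apply]

theorem det_updateRow_eq_sum_adjugate (M : Matrix (Fin m) (Fin m) ℝ) (s : Fin m) (v : Fin m → ℝ) :
    (M.updateRow s v).det = ∑ h, v h * M.adjugate h s := by
  rw [← cramer_transpose_apply, cramer_eq_adjugate_mulVec, ← adjugate_transpose]
  simp [mulVec, dotProduct, mul_comm]

/-- The kernel `∑ Y_h(y) m_h(z)` of the intertwining operator attached to `Y`. -/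
def casoratiKernel (y z : ℝ) : ℝ :=
  ∑ s : Fin m, ((casorati Y (z + (s : ℕ))).updateRow s fun h => (Y h).eval y).det

theorem casoratiKernel_mem (b : ℕ) (hY : ∀ h, (Y h).natDegree ≤ b + h) :
    casoratiKernel Y ∈ kernelSpace (m * b) := by
  classical
  let Q : Fin m → Equiv.Perm (Fin m) → ℝ[X] := fun L σ =>
    ∏ h ∈ univ.erase (σ⁻¹ L), (polyDiff (-1))^[(σ h : ℕ)] (Y h)
  have hdet : ∀ (L : Fin m) (y z : ℝ),
      ((diffMatrix Y z).updateRow L fun h => (Y h).eval y).det =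
        ∑ σ : Equiv.Perm (Fin m), (Equiv.Perm.sign σ : ℝ) *
          ((Y (σ⁻¹ L)).eval y * (Q L σ).eval z) := by
    intro L y z
    rw [det_apply']
    refine sum_congr rfl fun σ _ => ?_
    rw [← mul_prod_erase univ _ (mem_univ (σ⁻¹ L)), eval_prod]
    congr 2
    · simp
    · refine prod_congr rfl fun h hh => ?_
      have : σ h ≠ L := by
        rintro rfl
        simp at hh
      simp [updateRow_ne this, diffMatrix]
  have hK : casoratiKernel Y = ∑ L : Fin m, ∑ σ : Equiv.Perm (Fin m), (Equiv.Perm.sign σ : ℝ) •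
      (fun y z => (Y (σ⁻¹ L)).eval y * ((polyDiff 1)^[(L : ℕ)] (Q L σ)).eval z :
        ℝ → ℝ → ℝ) := by
    funext y z
    have h1 : ∀ s : Fin m,
        ((casorati Y (z + (s : ℕ))).updateRow s fun h => (Y h).eval y).det =
          ∑ L, (binomMatrix m).adjugate L s *
            ((diffMatrix Y (z + (s : ℕ))).updateRow L fun h => (Y h).eval y).det := by
      intro s
      simp only [det_updateRow_eq_sum_adjugate, casorati_eq, adjugate_mul_distrib, mul_apply,
        mul_sum]
      rw [sum_comm]
      refine sum_congr rfl fun L _ => sum_congr rfl fun h _ => ?_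
      ring
    simp only [casoratiKernel, h1, hdet, Finset.sum_apply, Pi.smul_apply, smul_eq_mul]
    rw [sum_comm]
    refine sum_congr rfl fun L _ => ?_
    simp only [mul_sum]
    rw [sum_comm]
    refine sum_congr rfl fun σ _ => ?_
    rw [← sum_adjugate_binomMatrix, mul_sum, mul_sum]
    refine sum_congr rfl fun s _ => ?_
    ring
  rw [hK]
  refine Submodule.sum_mem _ fun L _ => Submodule.sum_mem _ fun σ _ => Submodule.smul_mem _ _ ?_
  have hzero : (fun _ _ => 0 : ℝ → ℝ → ℝ) ∈ kernelSpace (m * b) := Submodule.zero_mem _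
  rcases polyDiff_iterate_eq_zero_or 1 (Q L σ) L with h0 | hL
  · simpa [h0] using hzero
  by_cases hQ : ∃ h ∈ univ.erase (σ⁻¹ L), (polyDiff (-1))^[(σ h : ℕ)] (Y h) = 0
  · have : Q L σ = 0 := prod_eq_zero_iff.2 hQ
    have h2 : ∀ z, ((polyDiff 1)^[(L : ℕ)] (Q L σ)).eval z = 0 := fun z => by
      rw [← sum_adjugate_binomMatrix, this]; simp
    simpa [h2] using hzero
  push Not at hQ
  refine Submodule.subset_span ⟨_, _, ?_, rfl⟩
  have hdeg : (Q L σ).natDegree + ∑ h ∈ univ.erase (σ⁻¹ L), (σ h : ℕ) ≤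
      ∑ h ∈ univ.erase (σ⁻¹ L), (b + (h : ℕ)) := by
    calc _ ≤ ∑ h ∈ univ.erase (σ⁻¹ L), ((polyDiff (-1))^[(σ h : ℕ)] (Y h)).natDegree +
          ∑ h ∈ univ.erase (σ⁻¹ L), (σ h : ℕ) := by
            gcongr
            exact natDegree_prod_le _ _
      _ = ∑ h ∈ univ.erase (σ⁻¹ L),
          (((polyDiff (-1))^[(σ h : ℕ)] (Y h)).natDegree + (σ h : ℕ)) := sum_add_distrib.symm
      _ ≤ _ := by
        refine sum_le_sum fun h hh => ?_
        rcases polyDiff_iterate_eq_zero_or (-1) (Y h) (σ h) with h3 | h3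
        · exact absurd h3 (hQ h hh)
        · exact h3.trans (hY h)
  have e1 : (∑ h ∈ univ.erase (σ⁻¹ L), (σ h : ℕ)) + L = ∑ h : Fin m, (h : ℕ) := by
    rw [← Equiv.sum_comp σ (fun h : Fin m => (h : ℕ)),
      ← sum_erase_add univ (fun h => (σ h : ℕ)) (mem_univ (σ⁻¹ L))]
    simp
  have e2 : (∑ h ∈ univ.erase (σ⁻¹ L), (b + (h : ℕ))) + (b + ((σ⁻¹ L : Fin m) : ℕ)) =
      m * b + ∑ h : Fin m, (h : ℕ) := by
    rw [sum_erase_add univ (fun h : Fin m => b + (h : ℕ)) (mem_univ (σ⁻¹ L)), sum_add_distrib]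
    simp
  have e3 := hY (σ⁻¹ L)
  omega

/-- The Casorati determinant of `Y` is a polynomial of degree at most `m b`. -/
theorem exists_det_casorati (b : ℕ) (hY : ∀ h, (Y h).natDegree ≤ b + h) :
    ∃ p : ℝ[X], p.natDegree ≤ m * b ∧ ∀ z, p.eval z = (casorati Y z).det := by
  classical
  refine ⟨∑ σ : Equiv.Perm (Fin m), C (Equiv.Perm.sign σ : ℝ) *
    ∏ h, (polyDiff (-1))^[(σ h : ℕ)] (Y h), ?_, fun z => ?_⟩
  · refine natDegree_sum_le_of_forall_le _ _ fun σ _ => (natDegree_C_mul_le _ _).trans ?_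
    by_cases hQ : ∃ h ∈ (univ : Finset (Fin m)), (polyDiff (-1))^[(σ h : ℕ)] (Y h) = 0
    · rw [prod_eq_zero_iff.2 hQ]
      simp
    push Not at hQ
    refine (natDegree_prod_le _ _).trans ?_
    have h1 : ∑ h, (((polyDiff (-1))^[(σ h : ℕ)] (Y h)).natDegree + (σ h : ℕ)) ≤
        ∑ h : Fin m, (b + (h : ℕ)) := by
      refine sum_le_sum fun h hh => ?_
      rcases polyDiff_iterate_eq_zero_or (-1) (Y h) (σ h) with h3 | h3
      · exact absurd h3 (hQ h hh)
      · exact h3.trans (hY h)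
    rw [sum_add_distrib, sum_add_distrib, Equiv.sum_comp σ (fun h : Fin m => (h : ℕ))] at h1
    simpa using h1
  · rw [det_casorati, det_apply', eval_finsetSum]
    refine sum_congr rfl fun σ _ => ?_
    rw [eval_mul, eval_C, eval_prod]
    simp [diffMatrix]

end Casorati


section Intertwining

open Polynomial Matrix

variable {m : ℕ} (Y : Fin m → ℝ[X]) {n : ℝ} {c : ℕ → ℝ}

theorem sum_mul_casoratiKernel (hc : ∀ h, ∑ j ∈ range (m + 1), c j * (Y h).eval (n - j) = 0)
    (z : ℝ) : ∑ j ∈ range (m + 1), c j * casoratiKernel Y (n - j) z = 0 := by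
  simp only [casoratiKernel, det_updateRow_eq_sum_adjugate, mul_sum]
  rw [sum_comm]
  refine sum_eq_zero fun s _ => ?_
  rw [sum_comm]
  refine sum_eq_zero fun h _ => ?_
  simp only [← mul_assoc, ← sum_mul]
  rw [hc, zero_mul]

theorem sum_mul_casoratiKernel_of_le
    (hc : ∀ h, ∑ j ∈ range (m + 1), c j * (Y h).eval (n - j) = 0) {P : ℝ → ℝ}
    (hP : ∀ z, P (z + 1) - P z = (casorati Y z).det) {l : ℕ} (hl : l ≤ m) :
    ∑ j ∈ range (l + 1), c j * casoratiKernel Y (n - j) (n - l) =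
      c l * (P (n - l + m) - P n) := by
  let D : Fin m → ℕ → ℝ := fun s j =>
    ((casorati Y (n - l + (s : ℕ))).updateRow s fun h => (Y h).eval (n - j)).det
  have hD0 : ∀ s : Fin m, ∀ j : ℕ, j ≠ l → l ≤ s + j → s + j < m + l → D s j = 0 := by
    intro s j hj h1 h2
    let i : Fin m := ⟨s + j - l, by omega⟩
    have his : s ≠ i := fun h => by
      have : (s : ℕ) = s + j - l := congrArg Fin.val h
      omega
    refine det_zero_of_row_eq his ?_
    funext h
    rw [updateRow_self, updateRow_ne his.symm]
    have : ((i : ℕ) : ℝ) = s + j - l := by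
      simp only [i]
      rw [Nat.cast_sub h1]
      push_cast
      ring
    simp only [casorati, of_apply, this]
    congr 1
    ring
  have hDl : ∀ s : Fin m, D s l = (casorati Y (n - l + (s : ℕ))).det := by
    intro s
    simp only [D]
    congr 1
    convert updateRow_eq_self (casorati Y (n - l + (s : ℕ))) s using 2
    funext h
    simp [casorati]
  have hsum : ∀ s, ∑ j ∈ range (m + 1), c j * D s j = 0 := by
    intro s
    simp only [D, det_updateRow_eq_sum_adjugate, mul_sum]
    rw [sum_comm]
    refine sum_eq_zero fun h _ => ?_
    simp only [← mul_assoc, ← sum_mul]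
    rw [hc, zero_mul]
  have hs : ∀ s : Fin m, ∑ j ∈ range (l + 1), c j * D s j =
      if l ≤ (s : ℕ) then c l * (P (n - l + (s : ℕ) + 1) - P (n - l + (s : ℕ))) else 0 := by
    intro s
    split_ifs with hsl
    · rw [sum_range_succ, hDl, hP, sum_eq_zero, zero_add]
      intro j hj
      have := mem_range.1 hj
      rw [hD0 s j (by omega) (by omega) (by omega), mul_zero]
    · rw [← hsum s]
      refine sum_subset (range_subset_range.2 (by omega)) fun j hj hj' => ?_
      rw [mem_range] at hj hj'
      rw [hD0 s j (by omega) (by omega) (by omega), mul_zero]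
  have h1 : ∑ j ∈ range (l + 1), c j * casoratiKernel Y (n - j) (n - l) =
      ∑ s, ∑ j ∈ range (l + 1), c j * D s j := by
    rw [sum_comm]
    simp only [casoratiKernel, mul_sum, D]
  rw [h1, sum_congr rfl fun s _ => hs s,
    Fin.sum_univ_eq_sum_range
      (fun s => if l ≤ s then c l * (P (n - l + s + 1) - P (n - l + s)) else 0) m]
  have h2 := sum_Ico_sub (fun s : ℕ => P (n - l + s)) hl
  rw [sub_add_cancel] at h2
  rw [← h2, mul_sum, ← sum_filter]
  refine sum_congr ?_ fun s _ => ?_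
  · ext s
    simp only [mem_filter, mem_range, mem_Ico]
    omega
  · push_cast
    ring_nf

/-- The operator intertwined with multiplication by `P` by the row operator with
coefficients `c`. -/
def intertwined (P : ℝ → ℝ) (f : ℕ → ℝ) (n : ℕ) : ℝ :=
  P (n + m) * f n - ∑ k ∈ range (n + 1), casoratiKernel Y n k * f k

theorem sum_mul_intertwined {n : ℕ}
    (hc : ∀ h, ∑ j ∈ range (m + 1), c j * (Y h).eval ((n : ℝ) - j) = 0) {P : ℝ → ℝ}
    (hP : ∀ z, P (z + 1) - P z = (casorati Y z).det) (f : ℕ → ℝ) :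
    ∑ j ∈ range (m + 1), c j * (if j ≤ n then intertwined Y P f (n - j) else 0) =
      P n * ∑ j ∈ range (m + 1), c j * (if j ≤ n then f (n - j) else 0) := by
  have key : ∑ j ∈ range (m + 1), c j * (if j ≤ n then
        ∑ k ∈ range (n - j + 1), casoratiKernel Y ((n - j : ℕ) : ℝ) k * f k else 0) =
      ∑ j ∈ range (m + 1),
        c j * (if j ≤ n then (P (n - j + m) - P n) * f (n - j) else 0) := by
    have h1 : ∀ j, (if j ≤ n then
        ∑ k ∈ range (n - j + 1), casoratiKernel Y ((n - j : ℕ) : ℝ) k * f k else 0) =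
        ∑ l ∈ range (n + 1), if j ≤ l then
          casoratiKernel Y ((n : ℝ) - j) ((n : ℝ) - l) * f (n - l) else 0 := by
      intro j
      split_ifs with hj
      · rw [← sum_filter, ← sum_range_reflect]
        refine sum_bij' (fun i _ => i + j) (fun l _ => l - j) ?_ ?_ ?_ ?_ ?_
        · intro i hi
          simp only [mem_range, mem_filter] at hi ⊢
          omega
        · intro i hi
          simp only [mem_range, mem_filter] at hi ⊢
          omega
        · intro i hi
          omega
        · intro i hi
          simp only [mem_range, mem_filter] at hi ⊢
          omega
        · intro i hi
          rw [mem_range] at hi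
          have e : n - j + 1 - 1 - i = n - (i + j) := by omega
          rw [e, Nat.cast_sub hj, Nat.cast_sub (by omega)]
      · symm
        refine sum_eq_zero fun l hl => if_neg ?_
        rw [mem_range] at hl
        omega
    have h2 : ∀ l ∈ range (n + 1), ∑ j ∈ range (m + 1), c j * (if j ≤ l then
        casoratiKernel Y ((n : ℝ) - j) ((n : ℝ) - l) * f (n - l) else 0) =
        if l ≤ m then c l * ((P (n - l + m) - P n) * f (n - l)) else 0 := by
      intro l _
      split_ifs with hl
      · rw [← mul_assoc, ← sum_mul_casoratiKernel_of_le Y hc hP hl, sum_mul]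
        symm
        refine sum_subset_zero_on_sdiff (range_subset_range.2 (by omega)) ?_ ?_
        · intro j hj
          simp only [mem_sdiff, mem_range] at hj
          rw [if_neg (by omega), mul_zero]
        · intro j hj
          rw [mem_range] at hj
          rw [if_pos (by omega), mul_assoc]
      · rw [← zero_mul (f (n - l)), ← sum_mul_casoratiKernel Y hc ((n : ℝ) - l), sum_mul]
        refine sum_congr rfl fun j hj => ?_
        rw [mem_range] at hj
        rw [if_pos (by omega), mul_assoc]
    simp only [h1, mul_sum]
    rw [sum_comm, sum_congr rfl h2, ← sum_filter]
    simp only [mul_ite, mul_zero]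
    rw [← sum_filter]
    refine sum_congr ?_ fun _ _ => rfl
    ext l
    simp only [mem_filter, mem_range]
    omega
  have h3 : ∀ j, c j * (if j ≤ n then intertwined Y P f (n - j) else 0) =
      c j * (if j ≤ n then P (n - j + m) * f (n - j) else 0) -
      c j * (if j ≤ n then
        ∑ k ∈ range (n - j + 1), casoratiKernel Y ((n - j : ℕ) : ℝ) k * f k else 0) := by
    intro j
    split_ifs with hj
    · rw [intertwined, Nat.cast_sub hj, mul_sub]
    · simp
  rw [sum_congr rfl fun j _ => h3 j, sum_sub_distrib, key, mul_sum, ← sum_sub_distrib]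
  refine sum_congr rfl fun j _ => ?_
  split_ifs <;> ring

theorem shiftRel_intertwined {n₀ d : ℕ} {F : ℕ → ℝ → ℝ}
    (h : ShiftRel n₀ 1 F (fun n x => (n : ℝ) * F n x))
    (hS : ShiftRel n₀ 1 F (fun n x => ∑ k ∈ range (n + 1), F k x))
    (hK : casoratiKernel Y ∈ kernelSpace d) (P : ℝ[X]) (hP : P.natDegree ≤ d + 1) :
    ShiftRel n₀ (d + 1) F (fun n x => intertwined Y (fun z => P.eval z) (fun k => F k x) n) := by
  have hker : ∀ K ∈ kernelSpace d, ShiftRel n₀ (d + 1) F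
      (fun n x => ∑ k ∈ range (n + 1), K n k * F k x) := by
    intro K hK
    induction hK using Submodule.span_induction with
    | mem K hK =>
      obtain ⟨p, q, hpq, rfl⟩ := hK
      exact (ShiftRel.kernel h hS p q).mono (by omega)
    | zero => simpa using ShiftRel.zero F
    | add K L _ _ hK hL => simpa only [Pi.add_apply, add_mul, sum_add_distrib] using hK.add hL
    | smul r K _ hK => simpa only [Pi.smul_apply, smul_eq_mul, mul_assoc, mul_sum] using hK.smul r
  have h1 := (h.polynomial (P.comp (X + C (m : ℝ)))).mono (r₂ := d + 1) (by
    rw [natDegree_comp, natDegree_X_add_C, mul_one]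
    exact hP)
  have h2 := h1.add ((hker _ hK).smul (-1))
  convert h2 using 3 with n x
  rw [intertwined, eval_comp, eval_add, eval_X, eval_C]
  ring

end Intertwining


section DualHahn

theorem poch_succ (x : ℝ) (m : ℕ) : poch x (m + 1) = poch x m * (x + m) := prod_range_succ _ _

theorem poch_succ_left (x : ℝ) (m : ℕ) : poch x (m + 1) = x * poch (x + 1) m := by
  rw [poch, prod_range_succ', mul_comm, poch]
  congr 1
  · simp
  · refine prod_congr rfl fun i _ => ?_
    push_cast
    ring

theorem poch_zero (x : ℝ) : poch x 0 = 1 := prod_range_zero _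

theorem poch_neg_natCast_mul_factorial {n j : ℕ} (h : j ≤ n) :
    poch (-(n : ℝ)) j * ((n - j).factorial : ℝ) = (-1) ^ j * (n.factorial : ℝ) := by
  induction j with
  | zero => simp [poch_zero]
  | succ j ih =>
    have e : n - j = n - (j + 1) + 1 := by omega
    have h1 : ((n - (j + 1) : ℕ) : ℝ) = n - (j + 1) := by
      rw [Nat.cast_sub h]
      push_cast
      ring
    have ih := ih (by omega)
    rw [e, Nat.factorial_succ] at ih
    push_cast at ih
    rw [h1] at ih
    rw [poch_succ, pow_succ]
    linear_combination (-1) * ih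

/-- The Newton basis of the lattice `λ^{a,b}`. -/
def latticeBasis (a b j : ℕ) (x : ℝ) : ℝ :=
  ∏ i ∈ range j, (lam a b x - i * ((a : ℝ) + b + 1 + i))

theorem latticeBasis_succ (a b j : ℕ) (x : ℝ) :
    latticeBasis a b (j + 1) x = latticeBasis a b j x * ((x - j) * (x + (a + b + 1) + j)) := by
  rw [latticeBasis, prod_range_succ, latticeBasis, lam]
  ring

theorem latticeBasis_zero (a b : ℕ) (x : ℝ) : latticeBasis a b 0 x = 1 := prod_range_zero _

theorem latticeBasis_succ_add_one (a b j : ℕ) (x : ℝ) :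
    (x + (a + b + 1)) * latticeBasis a b (j + 1) (x + 1) =
      (x + 1) * (x + (a + b + 1) + j) * (x + (a + b + 1) + j + 1) * latticeBasis a b j x := by
  induction j with
  | zero => simp [latticeBasis, lam]; ring
  | succ j ih =>
    rw [latticeBasis_succ, latticeBasis_succ a b j x, ← mul_assoc, ih]
    push_cast
    ring

theorem latticeBasis_succ_sub_one (a b j : ℕ) (x : ℝ) :
    x * latticeBasis a b (j + 1) (x - 1) =
      (x + (a + b + 1) - 1) * (x - j) * (x - j - 1) * latticeBasis a b j x := by
  induction j with
  | zero => simp [latticeBasis, lam]; ring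
  | succ j ih =>
    rw [latticeBasis_succ, latticeBasis_succ a b j x, ← mul_assoc, ih]
    push_cast
    ring

/-- Coefficients of the normalized dual Hahn polynomials in the Newton basis. -/
def dualHahnCoeff (a b N n j : ℕ) : ℝ :=
  if j ≤ n then (-1) ^ n * ((N + b - n).factorial : ℝ) *
    (poch (-(N : ℝ) + j) (n - j) * poch ((a : ℝ) + j + 1) (n - j) /
      ((j.factorial : ℝ) * ((n - j).factorial : ℝ))) else 0

/-- The normalized dual Hahn polynomials on the lattice. -/
def dualHahnSeq (a b N n : ℕ) (x : ℝ) : ℝ :=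
  (-1) ^ n * ((N + b - n).factorial : ℝ) * dualHahnNat a b N n (lam a b x)

variable (a b N : ℕ)

theorem dualHahnCoeff_of_lt {n j : ℕ} (h : n < j) : dualHahnCoeff a b N n j = 0 :=
  if_neg (not_le.2 h)

theorem dualHahnSeq_eq_sum {n K : ℕ} (hK : n < K) (x : ℝ) :
    dualHahnSeq a b N n x = ∑ j ∈ range K, dualHahnCoeff a b N n j * latticeBasis a b j x := by
  rw [← sum_subset (range_subset_range.2 (Nat.succ_le_of_lt hK)), dualHahnSeq, dualHahnNat,
    mul_sum]
  · refine sum_congr rfl fun j hj => ?_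
    have hj : j ≤ n := Nat.lt_succ_iff.1 (mem_range.1 hj)
    rw [dualHahnCoeff, if_pos hj, latticeBasis]
    have h := poch_neg_natCast_mul_factorial hj
    have h1 : ((n - j).factorial : ℝ) ≠ 0 := Nat.cast_ne_zero.2 (Nat.factorial_ne_zero _)
    have h2 : (n.factorial : ℝ) ≠ 0 := Nat.cast_ne_zero.2 (Nat.factorial_ne_zero _)
    have h3 : ((-1 : ℝ)) ^ j ≠ 0 := pow_ne_zero _ (by norm_num)
    rw [eq_div_of_mul_eq h1 h]
    field_simp
  · intro j _ hj
    rw [dualHahnCoeff_of_lt a b N (by simpa using hj), zero_mul]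

theorem dualHahnCoeff_rec (n j : ℕ) :
    ((n : ℝ) - j) * dualHahnCoeff a b N n j =
      -((j : ℝ) + 1) * (j + 1 + a) * (N - j) * dualHahnCoeff a b N n (j + 1) := by
  rcases lt_trichotomy j n with h | rfl | h
  · obtain ⟨k, rfl⟩ := Nat.exists_eq_add_of_lt h
    rw [dualHahnCoeff, if_pos (by omega), dualHahnCoeff, if_pos (by omega),
      show j + k + 1 - j = k + 1 by omega, show j + k + 1 - (j + 1) = k by omega,
      poch_succ_left, poch_succ_left, Nat.factorial_succ, Nat.factorial_succ]
    have h1 : (k.factorial : ℝ) ≠ 0 := Nat.cast_ne_zero.2 (Nat.factorial_ne_zero _)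
    have h2 : (j.factorial : ℝ) ≠ 0 := Nat.cast_ne_zero.2 (Nat.factorial_ne_zero _)
    have h3 : (k : ℝ) + 1 ≠ 0 := by positivity
    have h4 : (j : ℝ) + 1 ≠ 0 := by positivity
    have e1 : -(N : ℝ) + ((j + 1 : ℕ) : ℝ) = -(N : ℝ) + j + 1 := by push_cast; ring
    have e2 : (a : ℝ) + ((j + 1 : ℕ) : ℝ) + 1 = (a : ℝ) + j + 1 + 1 := by push_cast; ring
    rw [e1, e2]
    push_cast
    field_simp
    ring
  · rw [dualHahnCoeff_of_lt a b N (Nat.lt_succ_self j)]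
    ring
  · rw [dualHahnCoeff_of_lt a b N h, dualHahnCoeff_of_lt a b N (h.trans (Nat.lt_succ_self j))]
    ring

theorem dualHahnCoeff_succ {n j : ℕ} (hn : n + 1 ≤ N + b) (hj : j ≤ n) :
    ((n : ℝ) + 1 - j) * (N + b - n) * dualHahnCoeff a b N (n + 1) j =
      (N - n) * (a + n + 1) * dualHahnCoeff a b N n j := by
  obtain ⟨k, rfl⟩ := Nat.exists_eq_add_of_le hj
  rw [dualHahnCoeff, if_pos (by omega), dualHahnCoeff, if_pos hj,
    show j + k + 1 - j = k + 1 by omega, show j + k - j = k by omega,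
    poch_succ, poch_succ, Nat.factorial_succ,
    show N + b - (j + k) = N + b - (j + k + 1) + 1 by omega, Nat.factorial_succ]
  have h1 : (k.factorial : ℝ) ≠ 0 := Nat.cast_ne_zero.2 (Nat.factorial_ne_zero _)
  have h2 : (j.factorial : ℝ) ≠ 0 := Nat.cast_ne_zero.2 (Nat.factorial_ne_zero _)
  have h3 : (k : ℝ) + 1 ≠ 0 := by positivity
  push_cast [Nat.cast_sub hn]
  field_simp
  ring

theorem dualHahnCoeff_succ_self {n : ℕ} (hn : n + 1 ≤ N + b) :
    ((n : ℝ) + 1) * (N + b - n) * dualHahnCoeff a b N (n + 1) (n + 1) =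
      -dualHahnCoeff a b N n n := by
  rw [dualHahnCoeff, if_pos le_rfl, dualHahnCoeff, if_pos le_rfl,
    show N + b - n = N + b - (n + 1) + 1 by omega, Nat.factorial_succ (N + b - (n + 1)),
    Nat.factorial_succ n, Nat.sub_self, Nat.sub_self, poch_zero, poch_zero, poch_zero, poch_zero]
  have h2 : (n.factorial : ℝ) ≠ 0 := Nat.cast_ne_zero.2 (Nat.factorial_ne_zero _)
  have h4 : (n : ℝ) + 1 ≠ 0 := by positivity
  push_cast [Nat.cast_sub hn]
  field_simp
  ring

theorem dualHahnCoeff_diff {n : ℕ} (hn : n + 1 ≤ N + b) (i : ℕ) :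
    (dualHahnCoeff a b N (n + 1) (i + 1) - dualHahnCoeff a b N n (i + 1)) *
        ((i + 1) * (N + b - i)) +
      (dualHahnCoeff a b N (n + 1) (i + 2) - dualHahnCoeff a b N n (i + 2)) *
        ((i + 2) * (i + 1) * (i + 2 + a) * (N - i - 1)) =
    -dualHahnCoeff a b N n i - dualHahnCoeff a b N n (i + 1) * ((i + 1) * (a + b + 2 + i)) := by
  have r1 := dualHahnCoeff_rec a b N n i
  have r2 := dualHahnCoeff_rec a b N n (i + 1)
  have r3 := dualHahnCoeff_rec a b N (n + 1) (i + 1)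
  push_cast at r2 r3
  rw [add_assoc (i : ℕ) 1 1] at r2 r3
  norm_num at r2 r3
  rcases lt_trichotomy i n with h | rfl | h
  · have r4 := dualHahnCoeff_succ a b N hn (j := i + 1) h
    push_cast at r4
    have h1 : (n : ℝ) - i ≠ 0 := sub_ne_zero.2 (Nat.cast_lt.2 h).ne'
    apply mul_left_cancel₀ h1
    linear_combination ((i : ℝ) + 1) * r4 + ((n : ℝ) - i) * (i + 1) * (r3 - r2) + r1
  · have r4 := dualHahnCoeff_succ_self a b N hn
    have e0 := dualHahnCoeff_of_lt a b N (Nat.lt_succ_self i)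
    have e1 := dualHahnCoeff_of_lt a b N (show i < i + 2 by omega)
    have e2 := dualHahnCoeff_of_lt a b N (show i + 1 < i + 2 by omega)
    simp only [Nat.succ_eq_add_one] at e0
    rw [e0, e1, e2]
    linear_combination r4
  · rw [dualHahnCoeff_of_lt a b N h, dualHahnCoeff_of_lt a b N (show n + 1 < i + 1 by omega),
      dualHahnCoeff_of_lt a b N (show n < i + 1 by omega),
      dualHahnCoeff_of_lt a b N (show n + 1 < i + 2 by omega),
      dualHahnCoeff_of_lt a b N (show n < i + 2 by omega)]
    ring

theorem dualHahnSeq_difference (n : ℕ) (x : ℝ) :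
    (2 * x + (a + b + 1)) * (2 * x + (a + b + 1) - 1) * (2 * x + (a + b + 1) + 1) *
        (n * dualHahnSeq a b N n x) =
      -((x + a + 1) * (N - x) * (x + (a + b + 1)) * (2 * x + (a + b + 1) - 1) *
          (dualHahnSeq a b N n (x + 1) - dualHahnSeq a b N n x) +
        (x + b) * (x + (a + b + 1) + N) * x * (2 * x + (a + b + 1) + 1) *
          (dualHahnSeq a b N n (x - 1) - dualHahnSeq a b N n x)) := by
  set Δ : ℝ := (2 * x + (a + b + 1)) * (2 * x + (a + b + 1) - 1) * (2 * x + (a + b + 1) + 1)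
    with hΔ
  set U : ℝ := (x + a + 1) * (N - x) * (x + (a + b + 1)) * (2 * x + (a + b + 1) - 1) with hU
  set V : ℝ := (x + b) * (x + (a + b + 1) + N) * x * (2 * x + (a + b + 1) + 1) with hV
  have hterm : ∀ j : ℕ, U * (latticeBasis a b (j + 1) (x + 1) - latticeBasis a b (j + 1) x) +
      V * (latticeBasis a b (j + 1) (x - 1) - latticeBasis a b (j + 1) x) =
      Δ * (-((j : ℝ) + 1) * latticeBasis a b (j + 1) x +
        (j + 1) * (j + 1 + a) * (N - j) * latticeBasis a b j x) := by
    intro j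
    have h1 := latticeBasis_succ_add_one a b j x
    have h2 := latticeBasis_succ_sub_one a b j x
    rw [hU, hV, hΔ]
    rw [latticeBasis_succ a b j x]
    linear_combination (x + a + 1) * (N - x) * (2 * x + (a + b + 1) - 1) * h1 +
      (x + b) * (x + (a + b + 1) + N) * (2 * x + (a + b + 1) + 1) * h2
  clear_value Δ U V
  have e1 : ∀ y, dualHahnSeq a b N n y - dualHahnSeq a b N n x =
      ∑ j ∈ range (n + 1), dualHahnCoeff a b N n (j + 1) *
        (latticeBasis a b (j + 1) y - latticeBasis a b (j + 1) x) := by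
    intro y
    rw [dualHahnSeq_eq_sum a b N (show n < n + 2 by omega),
      dualHahnSeq_eq_sum a b N (show n < n + 2 by omega), ← sum_sub_distrib, sum_range_succ']
    simp only [latticeBasis_zero, sub_self, add_zero, mul_sub]
  have e2 : (n : ℝ) * dualHahnSeq a b N n x = ∑ j ∈ range (n + 1), dualHahnCoeff a b N n (j + 1) *
      (((j : ℝ) + 1) * latticeBasis a b (j + 1) x -
        (j + 1) * (j + 1 + a) * (N - j) * latticeBasis a b j x) := by
    have h3 : ∑ j ∈ range (n + 1), dualHahnCoeff a b N n (j + 1) *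
        (((j : ℝ) + 1) * latticeBasis a b (j + 1) x) =
        ∑ j ∈ range (n + 1), dualHahnCoeff a b N n j * ((j : ℝ) * latticeBasis a b j x) := by
      rw [sum_range_succ, dualHahnCoeff_of_lt a b N (Nat.lt_succ_self n), sum_range_succ']
      simp
    simp only [mul_sub, sum_sub_distrib]
    rw [h3, dualHahnSeq_eq_sum a b N (Nat.lt_succ_self n), mul_sum, ← sum_sub_distrib]
    refine sum_congr rfl fun j _ => ?_
    linear_combination latticeBasis a b j x * dualHahnCoeff_rec a b N n j
  rw [e1, e1, e2, mul_sum, mul_sum, mul_sum, ← sum_add_distrib, ← sum_neg_distrib]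
  refine sum_congr rfl fun j _ => ?_
  linear_combination dualHahnCoeff a b N n (j + 1) * hterm j

theorem dualHahnSeq_succ_difference {n : ℕ} (hn : n + 1 ≤ N + b) (x : ℝ) :
    x * ((x + a + 1) * (N - x) * (x + (a + b + 1)) * (2 * x + (a + b + 1) - 1)) *
        ((dualHahnSeq a b N (n + 1) (x + 1) - dualHahnSeq a b N n (x + 1)) -
          (dualHahnSeq a b N (n + 1) x - dualHahnSeq a b N n x)) -
      (x + (a + b + 1)) * ((x + b) * (x + (a + b + 1) + N) * x * (2 * x + (a + b + 1) + 1)) *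
        ((dualHahnSeq a b N (n + 1) (x - 1) - dualHahnSeq a b N n (x - 1)) -
          (dualHahnSeq a b N (n + 1) x - dualHahnSeq a b N n x)) =
    -((2 * x + (a + b + 1)) * (2 * x + (a + b + 1) - 1) * (2 * x + (a + b + 1) + 1) *
      (x * (x + (a + b + 1)) * dualHahnSeq a b N n x)) := by
  set Δ : ℝ := (2 * x + (a + b + 1)) * (2 * x + (a + b + 1) - 1) * (2 * x + (a + b + 1) + 1)
    with hΔ
  set U : ℝ := (x + a + 1) * (N - x) * (x + (a + b + 1)) * (2 * x + (a + b + 1) - 1) with hU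
  set V : ℝ := (x + b) * (x + (a + b + 1) + N) * x * (2 * x + (a + b + 1) + 1) with hV
  have hterm : ∀ j : ℕ,
      x * U * (latticeBasis a b (j + 1) (x + 1) - latticeBasis a b (j + 1) x) -
      (x + (a + b + 1)) * V * (latticeBasis a b (j + 1) (x - 1) - latticeBasis a b (j + 1) x) =
      Δ * (((j : ℝ) + 1) * (N + b - j) * latticeBasis a b (j + 1) x +
        (j + 1) * j * (j + 1 + a) * (N - j) * latticeBasis a b j x) := by
    intro j
    have h1 := latticeBasis_succ_add_one a b j x
    have h2 := latticeBasis_succ_sub_one a b j x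
    rw [hU, hV, hΔ]
    rw [latticeBasis_succ a b j x]
    linear_combination x * (x + a + 1) * (N - x) * (2 * x + (a + b + 1) - 1) * h1 -
      (x + (a + b + 1)) * (x + b) * (x + (a + b + 1) + N) * (2 * x + (a + b + 1) + 1) * h2
  clear_value Δ U V
  let δ : ℕ → ℝ := fun j => dualHahnCoeff a b N (n + 1) j - dualHahnCoeff a b N n j
  have e1 : ∀ y, (dualHahnSeq a b N (n + 1) y - dualHahnSeq a b N n y) -
        (dualHahnSeq a b N (n + 1) x - dualHahnSeq a b N n x) =
      ∑ j ∈ range (n + 2), δ (j + 1) *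
        (latticeBasis a b (j + 1) y - latticeBasis a b (j + 1) x) := by
    intro y
    simp only [dualHahnSeq_eq_sum a b N (show n + 1 < n + 3 by omega),
      dualHahnSeq_eq_sum a b N (show n < n + 3 by omega), ← sum_sub_distrib]
    rw [sum_range_succ']
    simp only [latticeBasis_zero, sub_self, add_zero, δ]
    exact sum_congr rfl fun j _ => by ring
  have e2 : ∑ j ∈ range (n + 2), δ (j + 1) *
      (((j : ℝ) + 1) * (N + b - j) * latticeBasis a b (j + 1) x +
        (j + 1) * j * (j + 1 + a) * (N - j) * latticeBasis a b j x) =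
      -(x * (x + (a + b + 1)) * dualHahnSeq a b N n x) := by
    have h3 : ∑ j ∈ range (n + 2), δ (j + 1) *
        (((j : ℝ) + 1) * j * (j + 1 + a) * (N - j) * latticeBasis a b j x) =
        ∑ j ∈ range (n + 2), δ (j + 2) *
          (((j : ℝ) + 2) * (j + 1) * (j + 2 + a) * (N - j - 1) * latticeBasis a b (j + 1) x) := by
      rw [sum_range_succ', sum_range_succ (n := n + 1)]
      have : δ (n + 1 + 2) = 0 := by
        simp only [δ]
        rw [dualHahnCoeff_of_lt a b N (show n + 1 < n + 1 + 2 by omega),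
          dualHahnCoeff_of_lt a b N (show n < n + 1 + 2 by omega), sub_zero]
      rw [this]
      simp only [Nat.cast_zero, mul_zero, zero_mul, add_zero]
      refine sum_congr rfl fun j _ => ?_
      push_cast
      ring
    have h4 : x * (x + (a + b + 1)) * dualHahnSeq a b N n x =
        ∑ j ∈ range (n + 2), (dualHahnCoeff a b N n j +
          dualHahnCoeff a b N n (j + 1) * ((j + 1) * (a + b + 2 + j))) *
            latticeBasis a b (j + 1) x := by
      have h5 : ∑ j ∈ range (n + 2), dualHahnCoeff a b N n (j + 1) *
          (((j : ℝ) + 1) * (a + b + 2 + j)) * latticeBasis a b (j + 1) x =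
          ∑ j ∈ range (n + 2), dualHahnCoeff a b N n j *
            ((j : ℝ) * (a + b + 1 + j)) * latticeBasis a b j x := by
        rw [sum_range_succ, dualHahnCoeff_of_lt a b N (show n < n + 1 + 1 by omega),
          sum_range_succ' (n := n + 1)]
        simp only [Nat.cast_zero, mul_zero, zero_mul, add_zero]
        refine sum_congr rfl fun j _ => ?_
        push_cast
        ring
      simp only [add_mul, sum_add_distrib]
      simp only [← add_mul]
      rw [h5, dualHahnSeq_eq_sum a b N (show n < n + 2 by omega), mul_sum, ← sum_add_distrib]
      refine sum_congr rfl fun j _ => ?_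
      rw [latticeBasis_succ]
      ring
    rw [sum_congr rfl fun j _ => mul_add _ _ _, sum_add_distrib, h3, h4, ← sum_add_distrib, ← sum_neg_distrib]
    refine sum_congr rfl fun j _ => ?_
    linear_combination latticeBasis a b (j + 1) x * dualHahnCoeff_diff a b N hn j
  rw [e1, e1, ← mul_neg, ← e2, mul_sum, mul_sum, mul_sum, ← sum_sub_distrib]
  refine sum_congr rfl fun j _ => ?_
  linear_combination δ (j + 1) * hterm j

theorem dualHahnSeq_partialSum {n : ℕ} (hn : n ≤ N + b) (x : ℝ) :
    (2 * x + (a + b + 1)) * (2 * x + (a + b + 1) - 1) * (2 * x + (a + b + 1) + 1) *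
        (x * (x + (a + b + 1))) * ∑ k ∈ range (n + 1), dualHahnSeq a b N k x =
      (2 * x + (a + b + 1)) * (2 * x + (a + b + 1) - 1) * (2 * x + (a + b + 1) + 1) *
        (x * (x + (a + b + 1))) * dualHahnSeq a b N n x -
      (x * ((x + a + 1) * (N - x) * (x + (a + b + 1)) * (2 * x + (a + b + 1) - 1)) *
        (dualHahnSeq a b N n (x + 1) - dualHahnSeq a b N n x) -
      (x + (a + b + 1)) * ((x + b) * (x + (a + b + 1) + N) * x * (2 * x + (a + b + 1) + 1)) *
        (dualHahnSeq a b N n (x - 1) - dualHahnSeq a b N n x)) := by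
  induction n with
  | zero =>
    have h : ∀ y, dualHahnSeq a b N 0 y = dualHahnCoeff a b N 0 0 := fun y => by
      rw [dualHahnSeq_eq_sum a b N Nat.zero_lt_one]
      simp [latticeBasis_zero]
    simp only [zero_add, range_one, sum_singleton, h]
    ring
  | succ n ih =>
    rw [sum_range_succ, mul_add, ih (by omega)]
    linear_combination dualHahnSeq_succ_difference a b N hn x

open Polynomial in
theorem ShiftRel.of_three {n₀ : ℕ} {F G : ℕ → ℝ → ℝ} {d u v w : ℝ[X]} (hd : d ≠ 0)
    (h : ∀ n ≤ n₀, ∀ x, d.eval x * G n x =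
      u.eval x * F n (x - 1) + v.eval x * F n x + w.eval x * F n (x + 1)) :
    ShiftRel n₀ 1 F G := by
  refine ⟨d, fun j => if j = -1 then u else if j = 0 then v else w, hd, fun n hn x => ?_⟩
  have : Icc (-((1 : ℕ) : ℤ)) ((1 : ℕ) : ℤ) = {-1, 0, 1} := rfl
  rw [h n hn x, this]
  simp [sub_eq_add_neg, add_assoc]

open Polynomial in
/-- The polynomial `(2x + s - 1)(2x + s)(2x + s + 1)` with `s = a + b + 1`. -/
def latticeDenom (a b : ℕ) : ℝ[X] :=
  (2 * X + C ((a : ℝ) + b + 1)) * (2 * X + C ((a : ℝ) + b + 1) - 1) *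
    (2 * X + C ((a : ℝ) + b + 1) + 1)

open Polynomial in
theorem latticeDenom_ne_zero : latticeDenom a b ≠ 0 := by
  intro h
  have h := congrArg (eval (1 : ℝ)) h
  simp only [latticeDenom, eval_add, eval_sub, eval_mul, eval_X, eval_C, eval_one, eval_ofNat,
    eval_zero, mul_one] at h
  have h1 : (0 : ℝ) < 2 + (a + b + 1) - 1 := by
    have : (0 : ℝ) ≤ a := Nat.cast_nonneg a
    have : (0 : ℝ) ≤ b := Nat.cast_nonneg b
    linarith
  have h2 : (0 : ℝ) < 2 + (a + b + 1) := by positivity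
  have h3 : (0 : ℝ) < 2 + (a + b + 1) + 1 := by positivity
  exact (mul_pos (mul_pos h2 h1) h3).ne' h

open Polynomial in
theorem shiftRel_dualHahnSeq_mul :
    ShiftRel (N + b) 1 (dualHahnSeq a b N) (fun n x => (n : ℝ) * dualHahnSeq a b N n x) := by
  let U : ℝ[X] := (X + C (a : ℝ) + 1) * (C (N : ℝ) - X) * (X + C ((a : ℝ) + b + 1)) *
    (2 * X + C ((a : ℝ) + b + 1) - 1)
  let V : ℝ[X] := (X + C (b : ℝ)) * (X + C ((a : ℝ) + b + 1) + C (N : ℝ)) * X *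
    (2 * X + C ((a : ℝ) + b + 1) + 1)
  refine ShiftRel.of_three (d := latticeDenom a b) (u := -V) (v := U + V) (w := -U)
    (latticeDenom_ne_zero a b) ?_
  intro n _ x
  have h := dualHahnSeq_difference a b N n x
  simp only [U, V, latticeDenom, eval_neg, eval_add, eval_sub, eval_mul, eval_X, eval_C, eval_one,
    eval_ofNat]
  linear_combination h

open Polynomial in
theorem shiftRel_dualHahnSeq_partialSum :
    ShiftRel (N + b) 1 (dualHahnSeq a b N)
      (fun n x => ∑ k ∈ range (n + 1), dualHahnSeq a b N k x) := by
  let U : ℝ[X] := (X + C (a : ℝ) + 1) * (C (N : ℝ) - X) * (X + C ((a : ℝ) + b + 1)) *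
    (2 * X + C ((a : ℝ) + b + 1) - 1)
  let V : ℝ[X] := (X + C (b : ℝ)) * (X + C ((a : ℝ) + b + 1) + C (N : ℝ)) * X *
    (2 * X + C ((a : ℝ) + b + 1) + 1)
  let d : ℝ[X] := latticeDenom a b * (X * (X + C ((a : ℝ) + b + 1)))
  refine ShiftRel.of_three (d := d) (u := (X + C ((a : ℝ) + b + 1)) * V)
    (v := d + X * U - (X + C ((a : ℝ) + b + 1)) * V) (w := -(X * U)) ?_ ?_
  · exact mul_ne_zero (latticeDenom_ne_zero a b) (mul_ne_zero X_ne_zero (X_add_C_ne_zero _))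
  · intro n hn x
    have h := dualHahnSeq_partialSum a b N hn x
    simp only [d, U, V, latticeDenom, eval_neg, eval_add, eval_sub, eval_mul, eval_X, eval_C,
      eval_one, eval_ofNat]
    linear_combination h

end DualHahn


section Hahn

/-- Coefficients of the Hahn polynomials in the basis `(-x)_j`. -/
def hahnCoeff (α β ν : ℝ) (n j : ℕ) : ℝ :=
  poch (-(n : ℝ)) j * poch (α + β + n + 1) j * poch (-ν + j) (n - j) *
    poch (α + j + 1) (n - j) / (j.factorial : ℝ)

/-- The second order difference operator of the Hahn polynomials. -/
def hahnOp (α β ν : ℝ) (f : ℝ → ℝ) (x : ℝ) : ℝ :=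
  (x + α + 1) * (x - ν) * (f (x + 1) - f x) + x * (x - β - ν - 1) * (f (x - 1) - f x)

theorem poch_add (x : ℝ) (m k : ℕ) : poch x (m + k) = poch x m * poch (x + m) k := by
  rw [poch, prod_range_add]
  refine congrArg _ (prod_congr rfl fun i _ => ?_)
  push_cast
  ring

theorem poch_neg_natCast_of_lt {n j : ℕ} (h : n < j) : poch (-(n : ℝ)) j = 0 :=
  prod_eq_zero (mem_range.2 h) (by simp)

theorem poch_ne_zero {x : ℝ} {m : ℕ} (h : ∀ i < m, x + i ≠ 0) : poch x m ≠ 0 :=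
  prod_ne_zero_iff.2 fun i hi => h i (mem_range.1 hi)

theorem poch_neg_add_one (x : ℝ) (m : ℕ) :
    (x + 1 - m) * poch (-(x + 1)) m = (x + 1) * poch (-x) m := by
  have h1 := poch_succ (-(x + 1)) m
  have h2 := poch_succ_left (-(x + 1)) m
  rw [show -(x + 1) + 1 = -x by ring] at h2
  linear_combination h1 - h2

theorem poch_neg_sub_one (x : ℝ) (m : ℕ) :
    x * poch (-(x - 1)) m = (x - m) * poch (-x) m := by
  have h := poch_neg_add_one (x - 1) m
  rw [sub_add_cancel] at h
  exact h.symm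

theorem hahnOp_poch (α β ν : ℝ) (j : ℕ) (x : ℝ) :
    hahnOp α β ν (fun y => poch (-y) (j + 1)) x =
      (j + 1) * (j + 2 + α + β) * poch (-x) (j + 1) -
        (j + 1) * (j + α + 1) * (-ν + j) * poch (-x) j := by
  have h1 := poch_succ_left (-(x + 1)) j
  rw [show -(x + 1) + 1 = -x by ring] at h1
  have h2 := poch_neg_sub_one x (j + 1)
  rw [hahnOp, h1]
  rw [poch_succ (-x)] at h2 ⊢
  push_cast at h2
  linear_combination (x - β - ν - 1) * h2

theorem hahnOp_sum (α β ν : ℝ) {ι : Type*} (s : Finset ι) (c : ι → ℝ) (f : ι → ℝ → ℝ) (x : ℝ) :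
    hahnOp α β ν (fun y => ∑ i ∈ s, c i * f i y) x = ∑ i ∈ s, c i * hahnOp α β ν (f i) x := by
  simp only [hahnOp, ← sum_sub_distrib, mul_sum, ← sum_add_distrib]
  exact sum_congr rfl fun i _ => by ring

theorem hahnCoeff_of_lt (α β ν : ℝ) {n j : ℕ} (h : n < j) : hahnCoeff α β ν n j = 0 := by
  rw [hahnCoeff, poch_neg_natCast_of_lt h]
  simp

theorem hahn_eq_sum (α β ν : ℝ) {n K : ℕ} (hK : n < K) (x : ℝ) :
    hahn α β ν n x = ∑ j ∈ range K, hahnCoeff α β ν n j * poch (-x) j := by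
  rw [← sum_subset (range_subset_range.2 (Nat.succ_le_of_lt hK))]
  · refine sum_congr rfl fun j _ => ?_
    rw [hahnCoeff]
    ring
  · intro j _ hj
    rw [hahnCoeff_of_lt α β ν (by simpa using hj), zero_mul]

theorem hahnCoeff_rec (α β ν : ℝ) (n j : ℕ) :
    hahnCoeff α β ν n (j + 1) * ((j + 1) * (α + j + 1) * (-ν + j)) =
      hahnCoeff α β ν n j * ((-n + j) * (α + β + n + 1 + j)) := by
  rcases lt_trichotomy j n with h | rfl | h
  · obtain ⟨k, rfl⟩ := Nat.exists_eq_add_of_lt h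
    rw [hahnCoeff, hahnCoeff, show j + k + 1 - j = k + 1 by omega,
      show j + k + 1 - (j + 1) = k by omega, poch_succ, poch_succ, poch_succ_left (-ν + j),
      poch_succ_left (α + j + 1), Nat.factorial_succ]
    have h2 : (j.factorial : ℝ) ≠ 0 := Nat.cast_ne_zero.2 (Nat.factorial_ne_zero _)
    have h4 : (j : ℝ) + 1 ≠ 0 := by positivity
    have e1 : -ν + ((j + 1 : ℕ) : ℝ) = -ν + j + 1 := by push_cast; ring
    have e2 : α + ((j + 1 : ℕ) : ℝ) + 1 = α + j + 1 + 1 := by push_cast; ring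
    rw [e1, e2]
    push_cast
    field_simp
  · rw [hahnCoeff_of_lt α β ν (Nat.lt_succ_self j)]
    ring
  · rw [hahnCoeff_of_lt α β ν h, hahnCoeff_of_lt α β ν (h.trans (Nat.lt_succ_self j))]
    ring

/-- Hahn polynomials are eigenfunctions of `hahnOp`. -/
theorem hahnOp_hahn (α β ν : ℝ) (n : ℕ) (x : ℝ) :
    hahnOp α β ν (hahn α β ν n) x = n * (n + α + β + 1) * hahn α β ν n x := by
  have e : hahn α β ν n = fun y => ∑ j ∈ range (n + 2), hahnCoeff α β ν n j * poch (-y) j :=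
    funext fun y => hahn_eq_sum α β ν (by omega) y
  have h0 : hahnOp α β ν (fun y => poch (-y) 0) x = 0 := by simp [hahnOp, poch_zero]
  conv_lhs => rw [e]
  rw [hahnOp_sum, sum_range_succ', h0, mul_zero, add_zero,
    hahn_eq_sum α β ν (Nat.lt_succ_self n) x, mul_sum]
  simp only [hahnOp_poch]
  have h3 : ∑ j ∈ range (n + 1), hahnCoeff α β ν n (j + 1) *
      ((j + 1) * (j + 2 + α + β) * poch (-x) (j + 1)) =
      ∑ j ∈ range (n + 1), hahnCoeff α β ν n j * (j * (j + 1 + α + β) * poch (-x) j) := by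
    rw [sum_range_succ, hahnCoeff_of_lt α β ν (Nat.lt_succ_self n), sum_range_succ' (n := n)]
    simp only [Nat.cast_zero, mul_zero, zero_mul, add_zero]
    refine sum_congr rfl fun j _ => ?_
    push_cast
    ring
  rw [sum_congr rfl fun j _ => mul_sub _ _ _, sum_sub_distrib, h3, ← sum_sub_distrib]
  refine sum_congr rfl fun j _ => ?_
  linear_combination -poch (-x) j * hahnCoeff_rec α β ν n j

theorem hahn_zero_right (α β ν : ℝ) (n : ℕ) :
    hahn α β ν n 0 = poch (-ν) n * poch (α + 1) n := by
  rw [hahn_eq_sum α β ν (Nat.lt_succ_self n), sum_range_succ', sum_eq_zero]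
  · simp [hahnCoeff, poch_zero]
  · intro j _
    rw [poch_succ_left]
    simp

open Polynomial in
theorem exists_polynomial_sum_poch (c : ℕ → ℝ) (g : ℕ) :
    ∃ p : ℝ[X], p.natDegree ≤ g ∧ ∀ x, p.eval x = ∑ j ∈ range (g + 1), c j * poch (-x) j := by
  refine ⟨∑ j ∈ range (g + 1), C (c j) * ∏ i ∈ range j, (-X + C (i : ℝ)), ?_, fun x => ?_⟩
  · refine natDegree_sum_le_of_forall_le _ _ fun j hj => (natDegree_C_mul_le _ _).trans ?_
    have h1 : ∀ i ∈ range j, (-X + C (i : ℝ) : ℝ[X]).natDegree ≤ 1 := fun i _ => by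
      refine (natDegree_add_le _ _).trans ?_
      simp
    refine (natDegree_prod_le _ _).trans ((sum_le_sum h1).trans ?_)
    have := mem_range.1 hj
    simp
    omega
  · rw [eval_finsetSum]
    refine sum_congr rfl fun j _ => ?_
    rw [eval_mul, eval_C, eval_prod, poch]
    simp

/-- For negative integer parameters, the Hahn polynomials of complementary degrees are
proportional. -/
theorem hahnCoeff_complement (a b : ℕ) (ν : ℝ) {g g' : ℕ} (hg : g + g' + 1 = a + b) (h : g' ≤ g)
    (j : ℕ) : hahnCoeff (-(a : ℝ)) (-(b : ℝ)) ν g j =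
      poch (-ν + g') (g - g') * poch (-(a : ℝ) + g' + 1) (g - g') *
        hahnCoeff (-(a : ℝ)) (-(b : ℝ)) ν g' j := by
  have hR : (g : ℝ) + g' + 1 = a + b := by exact_mod_cast hg
  have e1 : -(a : ℝ) + -b + g + 1 = -(g' : ℝ) := by linarith
  have e2 : -(a : ℝ) + -b + g' + 1 = -(g : ℝ) := by linarith
  rw [hahnCoeff, hahnCoeff, e1, e2]
  rcases lt_or_ge g' j with hj | hj
  · rw [poch_neg_natCast_of_lt hj]
    simp
  · have e3 : g - j = (g' - j) + (g - g') := by omega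
    have e4 : ((g' - j : ℕ) : ℝ) = g' - j := Nat.cast_sub hj
    rw [e3, poch_add, poch_add, e4,
      show -ν + (j : ℝ) + (g' - j) = -ν + g' by ring,
      show -(a : ℝ) + (j : ℝ) + 1 + (g' - j) = -a + g' + 1 by ring]
    ring

/-- Multiplication by `(-x)_a` intertwines two Hahn operators. -/
theorem hahnOp_poch_mul (a : ℕ) (β ν : ℝ) (k : ℝ → ℝ) (x : ℝ) :
    hahnOp (-(a : ℝ)) β ν (fun y => poch (-y) a * k (y - a)) x =
      poch (-x) a * (hahnOp a β (ν - a) k (x - a) + a * (1 + β) * k (x - a)) := by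
  have h1 := poch_neg_add_one x a
  have h2 := poch_neg_sub_one x a
  simp only [hahnOp]
  rw [show x + 1 - (a : ℝ) = x - a + 1 by ring] at h1 ⊢
  rw [show x - 1 - (a : ℝ) = x - a - 1 by ring]
  linear_combination (x - ν) * k (x - a + 1) * h1 + (x - β - ν - 1) * k (x - a - 1) * h2

end Hahn


section WPolynomials

theorem differentiableAt_poch {f : ℝ → ℝ} {s : ℝ} (hf : DifferentiableAt ℝ f s) (m : ℕ) :
    DifferentiableAt ℝ (fun t => poch (f t) m) s := by
  unfold poch
  exact DifferentiableAt.fun_finsetProd fun i _ => hf.add_const _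

theorem differentiableAt_hahnCoeff (a β ν : ℝ) (n j : ℕ) (s : ℝ) :
    DifferentiableAt ℝ (fun t => hahnCoeff (a - t) β ν n j) s := by
  have h1 := differentiableAt_poch (s := s) (f := fun t => a - t + β + n + 1) (by fun_prop) j
  have h2 := differentiableAt_poch (s := s) (f := fun t => a - t + j + 1) (by fun_prop) (n - j)
  unfold hahnCoeff
  fun_prop

theorem differentiableAt_hahn (a β ν : ℝ) (n : ℕ) (x s : ℝ) :
    DifferentiableAt ℝ (fun t => hahn (a - t) β ν n x) s := by
  have e : (fun t => hahn (a - t) β ν n x) =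
      fun t => ∑ j ∈ range (n + 1), hahnCoeff (a - t) β ν n j * poch (-x) j :=
    funext fun t => hahn_eq_sum _ _ _ (Nat.lt_succ_self n) x
  rw [e]
  exact DifferentiableAt.fun_sum fun j _ =>
    (differentiableAt_hahnCoeff a β ν n j s).mul_const _

variable {a b : ℕ} {ν : ℝ} {g g' : ℕ}

theorem hahn_zero_right_ne_zero (hν : ν < 0) (hg : g' < a) :
    hahn (-(a : ℝ) - 0) (-(b : ℝ)) ν g' 0 ≠ 0 := by
  rw [hahn_zero_right]
  refine mul_ne_zero (poch_ne_zero fun i _ => ?_) (poch_ne_zero fun i hi => ?_)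
  · have : (0 : ℝ) ≤ i := Nat.cast_nonneg i
    linarith
  · have : (i : ℝ) + 1 < a := by exact_mod_cast (show i + 1 < a by omega)
    intro h
    linarith

theorem hahn_sub_ratio_mul_eq_zero (hν : ν < 0) (hg : g + g' + 1 = a + b) (h : g' ≤ g)
    (hga : g' < a) (x : ℝ) :
    hahn (-(a : ℝ) - 0) (-(b : ℝ)) ν g x -
      hahn (-(a : ℝ) - 0) (-(b : ℝ)) ν g 0 / hahn (-(a : ℝ) - 0) (-(b : ℝ)) ν g' 0 *
        hahn (-(a : ℝ) - 0) (-(b : ℝ)) ν g' x = 0 := by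
  have h0 := hahn_zero_right_ne_zero (b := b) hν hga
  have key : ∀ y, hahn (-(a : ℝ) - 0) (-(b : ℝ)) ν g y =
      poch (-ν + g') (g - g') * poch (-(a : ℝ) + g' + 1) (g - g') *
        hahn (-(a : ℝ) - 0) (-(b : ℝ)) ν g' y := by
    intro y
    rw [hahn_eq_sum _ _ _ (Nat.lt_succ_self g), hahn_eq_sum _ _ _ (Nat.lt_succ_of_le h), mul_sum]
    refine sum_congr rfl fun j _ => ?_
    rw [sub_zero, hahnCoeff_complement a b ν hg h]
    ring
  rw [key x, key 0]
  field_simp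
  ring

theorem differentiableAt_hahn_ratio (hν : ν < 0) (hga : g' < a) :
    DifferentiableAt ℝ (fun s => hahn (-(a : ℝ) - s) (-(b : ℝ)) ν g 0 /
      hahn (-(a : ℝ) - s) (-(b : ℝ)) ν g' 0) 0 :=
  (differentiableAt_hahn _ _ _ g 0 0).div (differentiableAt_hahn _ _ _ g' 0 0)
    (hahn_zero_right_ne_zero hν hga)

/-- The operator `hahnOp` on the derivative of Hahn polynomials with respect to the first
parameter. -/
theorem hahnOp_deriv (hν : ν < 0) (hg : g + g' + 1 = a + b) (h : g' ≤ g) (hga : g' < a) (x : ℝ) :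
    hahnOp (-(a : ℝ)) (-(b : ℝ)) ν (fun y => deriv (fun s : ℝ =>
      hahn (-(a : ℝ) - s) (-(b : ℝ)) ν g y -
        hahn (-(a : ℝ) - s) (-(b : ℝ)) ν g 0 / hahn (-(a : ℝ) - s) (-(b : ℝ)) ν g' 0 *
          hahn (-(a : ℝ) - s) (-(b : ℝ)) ν g' y) 0) x =
      g * (g + -(a : ℝ) + -b + 1) * deriv (fun s : ℝ =>
        hahn (-(a : ℝ) - s) (-(b : ℝ)) ν g x -
          hahn (-(a : ℝ) - s) (-(b : ℝ)) ν g 0 / hahn (-(a : ℝ) - s) (-(b : ℝ)) ν g' 0 *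
            hahn (-(a : ℝ) - s) (-(b : ℝ)) ν g' x) 0 +
      (hahn (-(a : ℝ) - 0) (-(b : ℝ)) ν g 0 / hahn (-(a : ℝ) - 0) (-(b : ℝ)) ν g' 0 *
        ((g' : ℝ) - g)) * hahn (-(a : ℝ)) (-(b : ℝ)) ν g' x := by
  have hR : (g : ℝ) + g' + 1 = a + b := by exact_mod_cast hg
  set H : ℕ → ℝ → ℝ → ℝ := fun n s y => hahn (-(a : ℝ) - s) (-(b : ℝ)) ν n y with hH
  set κ : ℝ → ℝ := fun s => H g s 0 / H g' s 0 with hκ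
  set u : ℝ → ℝ → ℝ := fun s y => H g s y - κ s * H g' s y with hu
  have hHd : ∀ n y, DifferentiableAt ℝ (fun s => H n s y) 0 := fun n y =>
    differentiableAt_hahn _ _ _ n y 0
  have hκd : DifferentiableAt ℝ κ 0 := differentiableAt_hahn_ratio hν hga
  have hud : ∀ y, DifferentiableAt ℝ (fun s => u s y) 0 := fun y =>
    (hHd g y).sub (hκd.mul (hHd g' y))
  have hu0 : ∀ y, u 0 y = 0 := fun y => hahn_sub_ratio_mul_eq_zero hν hg h hga y
  have hop : ∀ s, (x + (-(a : ℝ) - s) + 1) * (x - ν) * (u s (x + 1) - u s x) +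
      x * (x - -(b : ℝ) - ν - 1) * (u s (x - 1) - u s x) =
      g * (g + (-(a : ℝ) - s) + -b + 1) * u s x +
        s * (κ s * ((g' : ℝ) - g) * H g' s x) := by
    intro s
    have h1 := hahnOp_hahn (-(a : ℝ) - s) (-b) ν g x
    have h2 := hahnOp_hahn (-(a : ℝ) - s) (-b) ν g' x
    simp only [hahnOp] at h1 h2
    simp only [hu, hH]
    linear_combination h1 - κ s * h2 -
      κ s * H g' s x * ((g' : ℝ) - g) * hR
  have hU := fun y => (hud y).hasDerivAt
  have d1 : HasDerivAt (fun s => (x + (-(a : ℝ) - s) + 1) * (x - ν)) (-(x - ν)) 0 := by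
    have := ((((hasDerivAt_id (0 : ℝ)).const_sub (-(a : ℝ))).const_add x).add_const 1).mul_const
      (x - ν)
    simpa using this
  have d2 : HasDerivAt (fun s => (g : ℝ) * (g + (-(a : ℝ) - s) + -b + 1)) (-g) 0 := by
    have := (((((hasDerivAt_id (0 : ℝ)).const_sub (-(a : ℝ))).const_add (g : ℝ)).add_const
      (-(b : ℝ))).add_const 1).const_mul (g : ℝ)
    simpa using this
  have d3 : HasDerivAt (fun s => s * (κ s * ((g' : ℝ) - g) * H g' s x))
      (κ 0 * ((g' : ℝ) - g) * H g' 0 x) 0 := by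
    have := (hasDerivAt_id (0 : ℝ)).mul
      ((hκd.mul_const ((g' : ℝ) - g)).mul (hHd g' x)).hasDerivAt
    rw [one_mul, id, zero_mul, add_zero] at this
    exact this
  have dl := (d1.mul ((hU (x + 1)).sub (hU x))).add
    (((hU (x - 1)).sub (hU x)).const_mul (x * (x - -(b : ℝ) - ν - 1)))
  have dr := (d2.mul (hU x)).add d3
  have heq := dl.unique (dr.congr_of_eventuallyEq (Filter.Eventually.of_forall hop))
  simp only [Pi.sub_apply, hu0, mul_zero, sub_self, zero_add] at heq
  rw [sub_zero (-(a : ℝ))] at heq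
  have hH0 : hahn (-(a : ℝ)) (-(b : ℝ)) ν g' x = H g' 0 x := by simp only [hH, sub_zero]
  rw [hH0]
  exact heq

end WPolynomials


section WSpace

open Polynomial

variable {a b N : ℕ} {M : ℕ → ℝ}

theorem W_of_le {g : ℕ} (h₁ : a ≤ g) (h₂ : g + 1 ≤ a + b) (Nr x : ℝ) :
    W a b Nr M g x = (-1 : ℝ) ^ (b + g) * ((g - b).factorial : ℝ) *
      (((a + b - g - 1).factorial : ℝ) * poch (-x) a *
          hahn (a : ℝ) (-(b : ℝ)) (-2 - Nr - a) (g - a) (x - a) +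
        ((g - a).factorial : ℝ) * poch (Nr + a + b + 1 - g) (2 * g - a - b + 1) / M (g - a) *
          hahn (-(a : ℝ)) (-(b : ℝ)) (-2 - Nr) (a + b - g - 1) x) := by
  rw [W, if_pos ⟨h₁, by omega⟩]

theorem W_of_ceilHalf_le {g : ℕ} (h₁ : ceilHalf a b ≤ g) (h₂ : g < a) (Nr x : ℝ) :
    W a b Nr M g x = deriv (fun s : ℝ =>
      hahn (-(a : ℝ) - s) (-(b : ℝ)) (-2 - Nr) g x -
        hahn (-(a : ℝ) - s) (-(b : ℝ)) (-2 - Nr) g 0 /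
            hahn (-(a : ℝ) - s) (-(b : ℝ)) (-2 - Nr) (a + b - g - 1) 0 *
          hahn (-(a : ℝ) - s) (-(b : ℝ)) (-2 - Nr) (a + b - g - 1) x) 0 := by
  rw [W, if_neg (by omega), if_pos ⟨h₁, h₂⟩]

theorem W_of_lt_ceilHalf (hba : b ≤ a) {g : ℕ} (h : g < ceilHalf a b) (Nr x : ℝ) :
    W a b Nr M g x = hahn (-(a : ℝ)) (-(b : ℝ)) (-2 - Nr) g x := by
  have : g < a := by rw [ceilHalf] at h; omega
  rw [W, if_neg (by omega), if_neg (by omega)]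

theorem exists_polynomial_hahn (α β ν : ℝ) (g : ℕ) :
    ∃ p : ℝ[X], p.natDegree ≤ g ∧ ∀ x, p.eval x = hahn α β ν g x := by
  obtain ⟨p, hp, h⟩ := exists_polynomial_sum_poch (hahnCoeff α β ν g) g
  exact ⟨p, hp, fun x => by rw [h, hahn_eq_sum _ _ _ (Nat.lt_succ_self g)]⟩

theorem exists_polynomial_poch (a : ℕ) :
    ∃ p : ℝ[X], p.natDegree ≤ a ∧ ∀ x, p.eval x = poch (-x) a := by
  obtain ⟨p, hp, h⟩ := exists_polynomial_sum_poch (fun j => if j = a then 1 else 0) a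
  refine ⟨p, hp, fun x => ?_⟩
  rw [h]
  simp

/-- The functions `W` are polynomials. -/
theorem exists_polynomial_W (hba : b ≤ a) {g : ℕ} (hg : g + 1 ≤ a + b) :
    ∃ p : ℝ[X], p.natDegree ≤ g ∧ ∀ x, p.eval x = W a b (N : ℝ) M g x := by
  have hν : -2 - (N : ℝ) < 0 := by linarith [(Nat.cast_nonneg N : (0 : ℝ) ≤ N)]
  rcases le_or_gt a g with hag | hag
  · obtain ⟨p, hp, h₁⟩ := exists_polynomial_poch a
    obtain ⟨q, hq, h₂⟩ := exists_polynomial_hahn a (-(b : ℝ)) (-2 - (N : ℝ) - a) (g - a)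
    obtain ⟨r, hr, h₃⟩ := exists_polynomial_hahn (-(a : ℝ)) (-b) (-2 - (N : ℝ)) (a + b - g - 1)
    refine ⟨C ((-1 : ℝ) ^ (b + g) * ((g - b).factorial : ℝ)) *
      (C ((a + b - g - 1).factorial : ℝ) * p * q.comp (X - C (a : ℝ)) +
        C (((g - a).factorial : ℝ) * poch (N + a + b + 1 - g) (2 * g - a - b + 1) / M (g - a)) *
          r), ?_, fun x => ?_⟩
    · refine (natDegree_C_mul_le _ _).trans (natDegree_add_le_of_degree_le ?_ ?_)
      · refine natDegree_mul_le.trans ?_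
        have e₁ := (natDegree_C_mul_le ((a + b - g - 1).factorial : ℝ) p).trans hp
        have e₂ : (q.comp (X - C (a : ℝ))).natDegree ≤ g - a := by
          rw [natDegree_comp, natDegree_X_sub_C, mul_one]
          exact hq
        omega
      · refine (natDegree_C_mul_le _ _).trans (hr.trans (by omega))
    · rw [W_of_le hag hg]
      simp [h₁, h₂, h₃]
  rcases le_or_gt (ceilHalf a b) g with hc | hc
  · set g' := a + b - g - 1 with hg'
    have hgg : g' ≤ g := by rw [ceilHalf] at hc; omega
    set κ : ℝ → ℝ := fun s => hahn (-(a : ℝ) - s) (-(b : ℝ)) (-2 - (N : ℝ)) g 0 /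
      hahn (-(a : ℝ) - s) (-(b : ℝ)) (-2 - (N : ℝ)) g' 0 with hκ
    have hκd : DifferentiableAt ℝ κ 0 := differentiableAt_hahn_ratio hν (by omega)
    set d : ℕ → ℝ → ℝ := fun j s => hahnCoeff (-(a : ℝ) - s) (-b) (-2 - (N : ℝ)) g j -
      κ s * hahnCoeff (-(a : ℝ) - s) (-b) (-2 - (N : ℝ)) g' j with hd
    have hdd : ∀ j, DifferentiableAt ℝ (d j) 0 := fun j =>
      (differentiableAt_hahnCoeff _ _ _ _ _ _).sub
        (hκd.mul (differentiableAt_hahnCoeff _ _ _ _ _ _))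
    obtain ⟨p, hp, h⟩ := exists_polynomial_sum_poch (fun j => deriv (d j) 0) g
    refine ⟨p, hp, fun x => ?_⟩
    rw [h, W_of_ceilHalf_le hc hag]
    have e : (fun s => hahn (-(a : ℝ) - s) (-(b : ℝ)) (-2 - (N : ℝ)) g x -
        κ s * hahn (-(a : ℝ) - s) (-(b : ℝ)) (-2 - (N : ℝ)) g' x) =
        fun s => ∑ j ∈ range (g + 1), d j s * poch (-x) j := by
      funext s
      rw [hahn_eq_sum _ _ _ (Nat.lt_succ_self g), hahn_eq_sum _ _ _ (Nat.lt_succ_of_le hgg),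
        mul_sum, ← sum_sub_distrib]
      exact sum_congr rfl fun j _ => by rw [hd]; ring
    have hs : HasDerivAt (fun s => ∑ j ∈ range (g + 1), d j s * poch (-x) j)
        (∑ j ∈ range (g + 1), deriv (d j) 0 * poch (-x) j) 0 :=
      HasDerivAt.fun_sum fun j _ => (hdd j).hasDerivAt.mul_const _
    rw [← e] at hs
    exact hs.deriv.symm
  · obtain ⟨p, hp, h⟩ := exists_polynomial_hahn (-(a : ℝ)) (-b) (-2 - (N : ℝ)) g
    exact ⟨p, hp, fun x => by rw [h, W_of_lt_ceilHalf hba hc]⟩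

/-- The Hahn operator acts triangularly on the functions `W`. -/
theorem exists_hahnOp_W (hba : b ≤ a) {g : ℕ} (hg : g + 1 ≤ a + b) (hbg : b ≤ g) :
    ∃ (κ : ℝ) (g' : ℕ), b ≤ g' ∧ g' + 1 ≤ a + b ∧ ∀ x,
      hahnOp (-(a : ℝ)) (-(b : ℝ)) (-2 - (N : ℝ)) (W a b (N : ℝ) M g) x =
        g * (g + -(a : ℝ) + -b + 1) * W a b (N : ℝ) M g x + κ * W a b (N : ℝ) M g' x := by
  have hν : -2 - (N : ℝ) < 0 := by linarith [(Nat.cast_nonneg N : (0 : ℝ) ≤ N)]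
  rcases le_or_gt a g with hag | hag
  · refine ⟨0, g, hbg, hg, fun x => ?_⟩
    rw [funext (W_of_le (M := M) hag hg (N : ℝ))]
    have h₁ := hahnOp_poch_mul a (-b) (-2 - (N : ℝ))
      (hahn a (-(b : ℝ)) (-2 - (N : ℝ) - a) (g - a)) x
    rw [hahnOp_hahn] at h₁
    have h₂ := hahnOp_hahn (-(a : ℝ)) (-b) (-2 - (N : ℝ)) (a + b - g - 1) x
    have e₁ : ((a + b - g - 1 : ℕ) : ℝ) = a + b - g - 1 := by
      rw [Nat.sub_sub, Nat.cast_sub hg]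
      push_cast
      ring
    rw [e₁] at h₂
    rw [Nat.cast_sub hag] at h₁
    simp only [hahnOp] at h₁ h₂ ⊢
    linear_combination (-1 : ℝ) ^ (b + g) * ((g - b).factorial : ℝ) *
      (((a + b - g - 1).factorial : ℝ) * h₁ +
        ((g - a).factorial : ℝ) * poch (N + a + b + 1 - g) (2 * g - a - b + 1) / M (g - a) * h₂)
  rcases le_or_gt (ceilHalf a b) g with hc | hc
  · have hgg : a + b - g - 1 ≤ g ∧ a + b - g - 1 < ceilHalf a b := by
      rw [ceilHalf] at hc ⊢; omega
    refine ⟨hahn (-(a : ℝ) - 0) (-(b : ℝ)) (-2 - (N : ℝ)) g 0 /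
      hahn (-(a : ℝ) - 0) (-(b : ℝ)) (-2 - (N : ℝ)) (a + b - g - 1) 0 *
        (((a + b - g - 1 : ℕ) : ℝ) - g), a + b - g - 1, by omega, by omega, fun x => ?_⟩
    rw [funext (W_of_ceilHalf_le (M := M) hc hag (N : ℝ)), W_of_lt_ceilHalf hba hgg.2]
    exact hahnOp_deriv hν (by omega) hgg.1 (by omega) x
  · refine ⟨0, g, hbg, hg, fun x => ?_⟩
    rw [funext (W_of_lt_ceilHalf (M := M) hba hc (N : ℝ)), hahnOp_hahn]
    ring

/-- The span of `W_b, …, W_{a+b-1}`. -/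
def WSpan (a b N : ℕ) (M : ℕ → ℝ) : Submodule ℝ (ℝ → ℝ) :=
  Submodule.span ℝ (Set.range fun h : Fin a => W a b (N : ℝ) M (b + h))

theorem W_mem_WSpan {g : ℕ} (hg : g + 1 ≤ a + b) (hbg : b ≤ g) :
    W a b (N : ℝ) M g ∈ WSpan a b N M :=
  Submodule.subset_span ⟨⟨g - b, by omega⟩, by simp [Nat.add_sub_cancel' hbg]⟩

theorem hahnOp_mem_WSpan (hba : b ≤ a) {f : ℝ → ℝ} (hf : f ∈ WSpan a b N M) :
    hahnOp (-(a : ℝ)) (-(b : ℝ)) (-2 - (N : ℝ)) f ∈ WSpan a b N M := by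
  refine Submodule.span_induction ?_ ?_ ?_ ?_ hf
  · rintro _ ⟨h, rfl⟩
    obtain ⟨κ, g', h₁, h₂, H⟩ :=
      exists_hahnOp_W (N := N) (M := M) hba (g := b + h) (by omega) (by omega)
    rw [funext H]
    exact Submodule.add_mem _ (Submodule.smul_mem _ _ (W_mem_WSpan (by omega) (by omega)))
      (Submodule.smul_mem _ _ (W_mem_WSpan h₂ h₁))
  · convert Submodule.zero_mem (WSpan a b N M)
    simp [funext_iff, hahnOp]
  · intro f g _ _ hf hg
    convert Submodule.add_mem _ hf hg using 1
    funext x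
    simp only [hahnOp, Pi.add_apply]
    ring
  · intro c f _ hf
    convert Submodule.smul_mem _ c hf using 1
    funext x
    simp only [hahnOp, Pi.smul_apply, smul_eq_mul]
    ring

theorem exists_polynomial_of_mem_WSpan (hba : b ≤ a) {f : ℝ → ℝ} (hf : f ∈ WSpan a b N M) :
    ∃ p : ℝ[X], p.natDegree ≤ a + b - 1 ∧ ∀ x, p.eval x = f x := by
  refine Submodule.span_induction ?_ ?_ ?_ ?_ hf
  · rintro _ ⟨h, rfl⟩
    obtain ⟨p, hp, H⟩ := exists_polynomial_W (N := N) (M := M) hba (g := b + h)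
      (by omega)
    exact ⟨p, hp.trans (by omega), H⟩
  · exact ⟨0, by simp, by simp⟩
  · rintro f g _ _ ⟨p, hp, hf⟩ ⟨q, hq, hg⟩
    exact ⟨p + q, natDegree_add_le_of_degree_le hp hq, fun x => by simp [hf, hg]⟩
  · rintro c f _ ⟨p, hp, hf⟩
    exact ⟨C c * p, (natDegree_C_mul_le _ _).trans hp, fun x => by simp [hf]⟩

end WSpace

section Casoratian

open Polynomial Matrix

variable {a b N : ℕ} {M : ℕ → ℝ}

theorem exists_mem_WSpan_eq_single (h : PhiM a b N M 0 ≠ 0) (ha : 1 ≤ a) :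
    ∃ Z ∈ WSpan a b N M, Z ((a : ℝ) - 1) = 1 ∧ ∀ x : ℤ, 0 ≤ x → x < a - 1 → Z x = 0 := by
  set A : Matrix (Fin a) (Fin a) ℝ := Matrix.of fun i j =>
    W a b (N : ℝ) M (b + (i : ℕ)) (-((0 : ℕ) : ℝ) + ((j : ℕ) : ℝ)) with hA
  obtain ⟨c, hc⟩ := vecMul_surjective_iff_isUnit.2
    ((Matrix.isUnit_iff_isUnit_det A).2 (isUnit_iff_ne_zero.2 h))
    (Pi.single ⟨a - 1, by omega⟩ 1)
  have hZ : ∀ j : Fin a, (∑ i, c i • W a b (N : ℝ) M (b + (i : ℕ))) ((j : ℕ) : ℝ) =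
      (Pi.single ⟨a - 1, by omega⟩ 1 : Fin a → ℝ) j := by
    intro j
    rw [← hc]
    simp [vecMul, dotProduct, hA]
  refine ⟨∑ i, c i • W a b (N : ℝ) M (b + (i : ℕ)), ?_, ?_, fun x h0 hx => ?_⟩
  · exact Submodule.sum_mem _ fun i _ => Submodule.smul_mem _ _
      (W_mem_WSpan (by omega) (by omega))
  · have := hZ ⟨a - 1, by omega⟩
    rw [Pi.single_eq_same] at this
    simpa [Nat.cast_sub ha] using this
  · lift x to ℕ using h0
    have := hZ ⟨x, by omega⟩
    rw [Pi.single_eq_of_ne (by rw [Ne, Fin.mk.injEq]; omega)] at this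
    exact_mod_cast this

theorem exists_ne_zero_of_mem_WSpan (hba : b ≤ a) (ha : 1 ≤ a) (hN : 1 ≤ N) {Z : ℝ → ℝ}
    (hZ : Z ∈ WSpan a b N M) (h1 : Z ((a : ℝ) - 1) = 1)
    (h0 : ∀ x : ℤ, 0 ≤ x → x < a - 1 → Z x = 0) :
    ∃ k : ℕ, 1 ≤ k ∧ k ≤ N + b ∧ Z (-(k : ℝ)) ≠ 0 := by
  by_contra! H
  obtain ⟨p, hp, hpZ⟩ := exists_polynomial_of_mem_WSpan hba hZ
  have hp0 : p = 0 := by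
    refine eq_zero_of_natDegree_lt_card_of_eval_eq_zero p
      (f := fun i : Fin (a + N + b - 1) => (((a : ℤ) - 2 - (i : ℕ) : ℤ) : ℝ)) ?_ ?_ ?_
    · intro i j hij
      have := Int.cast_injective (α := ℝ) hij
      omega
    · intro i
      rw [hpZ]
      rcases lt_or_ge ((a : ℤ) - 2 - (i : ℕ)) 0 with hx | hx
      · obtain ⟨k, hk⟩ := Int.eq_ofNat_of_zero_le (show 0 ≤ -((a : ℤ) - 2 - (i : ℕ)) by omega)
        have := H k (by omega) (by omega)
        rw [show ((a : ℤ) - 2 - (i : ℕ)) = -(k : ℤ) by omega]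
        exact_mod_cast this
      · exact h0 _ hx (by omega)
    · rw [Fintype.card_fin]
      omega
  rw [← hpZ, hp0, eval_zero] at h1
  exact zero_ne_one h1

section Waves

variable {Z : ℝ → ℝ} {k : ℕ}

theorem hahnOp_zero_params (f : ℝ → ℝ) (x : ℤ) :
    hahnOp (-(a : ℝ)) (-(b : ℝ)) (-2 - (N : ℝ)) f x =
      ((x - a + 1) * (x + N + 2) : ℤ) * (f ((x + 1 : ℤ) : ℝ) - f x) +
        (x * (x + b + N + 1) : ℤ) * (f ((x - 1 : ℤ) : ℝ) - f x) := by
  rw [hahnOp]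
  push_cast
  ring

/-- Iterates of the Hahn operator on a function supported on the two sides of an interval. -/
theorem iterate_hahnOp_eq_zero (h0 : ∀ x : ℤ, 0 ≤ x → x < a - 1 → Z x = 0)
    (hneg : ∀ x : ℤ, -k < x → x < 0 → Z x = 0) (i : ℕ) (hi : i < a) :
    (∀ x : ℤ, -k + i < x → x < 0 →
      (hahnOp (-(a : ℝ)) (-(b : ℝ)) (-2 - (N : ℝ)))^[i] Z x = 0) ∧
    (∀ x : ℤ, 0 ≤ x → x < a - 1 - i →
      (hahnOp (-(a : ℝ)) (-(b : ℝ)) (-2 - (N : ℝ)))^[i] Z x = 0) := by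
  induction i with
  | zero =>
    simp only [Function.iterate_zero, id, Nat.cast_zero, add_zero, sub_zero]
    exact ⟨hneg, h0⟩
  | succ i ih =>
    obtain ⟨ih₁, ih₂⟩ := ih (by omega)
    push_cast
    simp only [Function.iterate_succ_apply', hahnOp_zero_params]
    refine ⟨fun x h₁ h₂ => ?_, fun x h₁ h₂ => ?_⟩
    · rw [ih₁ x (by omega) h₂, ih₁ (x - 1) (by omega) (by omega)]
      rcases eq_or_ne x (-1) with rfl | hx
      · rw [ih₂ _ (by omega) (by omega)]
        ring
      · rw [ih₁ _ (by omega) (by omega)]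
        ring
    · rw [ih₂ x h₁ (by omega), ih₂ (x + 1) (by omega) (by omega)]
      rcases eq_or_ne x 0 with rfl | hx
      · simp
      · rw [ih₂ _ (by omega) (by omega)]
        ring

theorem iterate_hahnOp_left_ne_zero (h0 : ∀ x : ℤ, 0 ≤ x → x < a - 1 → Z x = 0)
    (hneg : ∀ x : ℤ, -k < x → x < 0 → Z x = 0) (hk : k ≤ N + b) (hZ : Z ((-k : ℤ) : ℝ) ≠ 0)
    (i : ℕ) (hi : i < a) (hik : i < k) :
    (hahnOp (-(a : ℝ)) (-(b : ℝ)) (-2 - (N : ℝ)))^[i] Z ((-k + i : ℤ) : ℝ) ≠ 0 := by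
  induction i with
  | zero => simpa using hZ
  | succ i ih =>
    obtain ⟨h₁, h₂⟩ := iterate_hahnOp_eq_zero (b := b) (N := N) h0 hneg i (by omega)
    have ih := ih (by omega) (by omega)
    rw [Function.iterate_succ_apply', hahnOp_zero_params,
      h₁ (-k + (i + 1 : ℕ)) (by omega) (by omega)]
    have h₃ : (hahnOp (-(a : ℝ)) (-(b : ℝ)) (-2 - (N : ℝ)))^[i] Z
        ((-k + (i + 1 : ℕ) + 1 : ℤ) : ℝ) = 0 := by
      rcases eq_or_ne k (i + 2) with hx | hx
      · exact h₂ _ (by omega) (by omega)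
      · exact h₁ _ (by omega) (by omega)
    rw [h₃, show (-k + (i + 1 : ℕ) - 1 : ℤ) = -k + i by omega, sub_zero, mul_zero, zero_add,
      sub_zero]
    refine mul_ne_zero (Int.cast_ne_zero.2 (mul_ne_zero ?_ ?_)) ih <;> omega

theorem iterate_hahnOp_right_ne_zero (h0 : ∀ x : ℤ, 0 ≤ x → x < a - 1 → Z x = 0)
    (hneg : ∀ x : ℤ, -k < x → x < 0 → Z x = 0) (hZ : Z ((a - 1 : ℤ) : ℝ) ≠ 0)
    (i : ℕ) (hi : i < a) :
    (hahnOp (-(a : ℝ)) (-(b : ℝ)) (-2 - (N : ℝ)))^[i] Z ((a - 1 - i : ℤ) : ℝ) ≠ 0 := by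
  induction i with
  | zero => simpa using hZ
  | succ i ih =>
    obtain ⟨-, h₂⟩ := iterate_hahnOp_eq_zero (b := b) (N := N) h0 hneg i (by omega)
    have ih := ih (by omega)
    rw [Function.iterate_succ_apply', hahnOp_zero_params,
      h₂ (a - 1 - (i + 1 : ℕ)) (by omega) (by omega),
      show (a - 1 - (i + 1 : ℕ) + 1 : ℤ) = a - 1 - i by omega]
    have h₃ : (((a - 1 - (i + 1 : ℕ)) * (a - 1 - (i + 1 : ℕ) + b + N + 1) : ℤ) : ℝ) *
        ((hahnOp (-(a : ℝ)) (-(b : ℝ)) (-2 - (N : ℝ)))^[i] Z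
          ((a - 1 - (i + 1 : ℕ) - 1 : ℤ) : ℝ) - 0) = 0 := by
      rcases eq_or_ne ((a : ℤ) - 1 - (i + 1 : ℕ)) 0 with hx | hx
      · rw [hx]
        simp
      · rw [h₂ _ (by omega) (by omega)]
        simp
    rw [h₃, add_zero, sub_zero]
    refine mul_ne_zero (Int.cast_ne_zero.2 (mul_ne_zero ?_ ?_)) ih <;> omega

theorem iterate_hahnOp_mem_WSpan (hba : b ≤ a) (hZ : Z ∈ WSpan a b N M) (i : ℕ) :
    (hahnOp (-(a : ℝ)) (-(b : ℝ)) (-2 - (N : ℝ)))^[i] Z ∈ WSpan a b N M := by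
  induction i with
  | zero => exact hZ
  | succ i ih =>
    rw [Function.iterate_succ_apply']
    exact hahnOp_mem_WSpan hba ih

theorem PhiM_ne_zero (hba : b ≤ a) (hZm : Z ∈ WSpan a b N M)
    (h0 : ∀ x : ℤ, 0 ≤ x → x < a - 1 → Z x = 0)
    (hneg : ∀ x : ℤ, -k < x → x < 0 → Z x = 0) (hk : k ≤ N + b)
    (hZ₁ : Z ((a - 1 : ℤ) : ℝ) ≠ 0) (hZ₂ : Z ((-k : ℤ) : ℝ) ≠ 0) :
    PhiM a b N M k ≠ 0 := by
  intro h
  obtain ⟨v, hv0, hv⟩ := Matrix.exists_mulVec_eq_zero_iff.2 h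
  have hF : ∀ F ∈ WSpan a b N M, ∑ j : Fin a, F ((-k + (j : ℕ) : ℤ) : ℝ) * v j = 0 := by
    intro F hF
    refine Submodule.span_induction ?_ (by simp) ?_ ?_ hF
    · rintro _ ⟨i, rfl⟩
      have := congrFun hv i
      simpa [mulVec, dotProduct] using this
    · intro f g _ _ hf hg
      simp only [Pi.add_apply, add_mul, sum_add_distrib, hf, hg, add_zero]
    · intro c f _ hf
      simp only [Pi.smul_apply, smul_eq_mul, mul_assoc, ← mul_sum, hf, mul_zero]
  have hL : ∀ i : ℕ, ∀ hi : i < a, i < k → v ⟨i, hi⟩ = 0 := by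
    intro i
    induction i using Nat.strong_induction_on with
    | _ i ih =>
    intro hi hik
    obtain ⟨h₁, h₂⟩ := iterate_hahnOp_eq_zero (b := b) (N := N) h0 hneg i hi
    have := hF _ (iterate_hahnOp_mem_WSpan hba hZm i)
    rw [sum_eq_single ⟨i, hi⟩ ?_ (by simp)] at this
    · exact (mul_eq_zero.1 this).resolve_left
        (iterate_hahnOp_left_ne_zero h0 hneg hk hZ₂ i hi hik)
    · rintro ⟨j, hj⟩ - hji
      rw [Ne, Fin.mk.injEq] at hji
      rcases lt_or_gt_of_ne hji with h | h
      · rw [ih j h hj (by omega), mul_zero]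
      · rcases lt_or_ge j k with hjk | hjk
        · rw [h₁ _ (by simp only; omega) (by simp only; omega), zero_mul]
        · rw [h₂ _ (by simp only; omega) (by simp only; omega), zero_mul]
  have hR : ∀ i (_ : k ≤ i) (_ : i < a), v ⟨a - 1 - i + k, by omega⟩ = 0 := by
    intro i
    induction i using Nat.strong_induction_on with
    | _ i ih =>
    intro hik hi
    obtain ⟨h₁, h₂⟩ := iterate_hahnOp_eq_zero (b := b) (N := N) h0 hneg i hi
    have := hF _ (iterate_hahnOp_mem_WSpan hba hZm i)
    rw [sum_eq_single ⟨a - 1 - i + k, by omega⟩ ?_ (by simp)] at this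
    · refine (mul_eq_zero.1 this).resolve_left ?_
      have e : (-k + (a - 1 - i + k : ℕ) : ℤ) = a - 1 - i := by omega
      simp only [e]
      exact iterate_hahnOp_right_ne_zero h0 hneg hZ₁ i hi
    · rintro ⟨j, hj⟩ - hji
      rw [Ne, Fin.mk.injEq] at hji
      rcases lt_or_ge j k with hjk | hjk
      · rw [hL j hj hjk, mul_zero]
      · rcases lt_or_gt_of_ne hji with h | h
        · rw [h₂ _ (by simp only; omega) (by simp only; omega), zero_mul]
        · have := ih (a - 1 - j + k) (by omega) (by omega) (by omega)
          have e : a - 1 - (a - 1 - j + k) + k = j := by omega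
          simp only [e] at this
          rw [this, mul_zero]
  refine hv0 (funext fun ⟨j, hj⟩ => ?_)
  rcases lt_or_ge j k with hjk | hjk
  · exact hL j hj hjk
  · have := hR (a - 1 - j + k) (by omega) (by omega)
    have e : a - 1 - (a - 1 - j + k) + k = j := by omega
    simp only [e] at this
    exact this

end Waves

/-- If the Casoratian does not vanish at `0`, it does not vanish at some later index either. -/
theorem exists_PhiM_ne_zero (hba : b ≤ a) (ha : 1 ≤ a) (hN : 1 ≤ N) (h : PhiM a b N M 0 ≠ 0) :
    ∃ k, 1 ≤ k ∧ k ≤ N + b ∧ PhiM a b N M k ≠ 0 := by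
  classical
  obtain ⟨Z, hZ, h1, h0⟩ := exists_mem_WSpan_eq_single h ha
  have H := exists_ne_zero_of_mem_WSpan hba ha hN hZ h1 h0
  obtain ⟨hk1, hkN, hkZ⟩ := Nat.find_spec H
  refine ⟨Nat.find H, hk1, hkN, PhiM_ne_zero hba hZ h0 (fun x h₁ h₂ => ?_) hkN ?_ ?_⟩
  · obtain ⟨l, rfl⟩ := Int.exists_eq_neg_ofNat h₂.le
    have := Nat.find_min H (m := l) (by omega)
    by_contra hl
    refine this ⟨by omega, by omega, ?_⟩
    exact_mod_cast hl
  · push_cast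
    rw [h1]
    exact one_ne_zero
  · push_cast
    exact hkZ

end Casoratian

section Bispectral

open Polynomial Matrix

theorem ShiftRel.convolution {n₀ r : ℕ} {F G : ℕ → ℝ → ℝ} (h : ShiftRel n₀ r F G)
    (m : ℕ) (w : ℕ → ℕ → ℝ) :
    ShiftRel n₀ r (fun n x => ∑ j ∈ range m, w n j * (if j ≤ n then F (n - j) x else 0))
      (fun n x => ∑ j ∈ range m, w n j * (if j ≤ n then G (n - j) x else 0)) := by
  obtain ⟨d, c, hd, h⟩ := h
  refine ⟨d, c, hd, fun n hn x => ?_⟩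
  simp only [mul_sum]
  rw [sum_comm]
  refine sum_congr rfl fun j _ => ?_
  split_ifs
  · rw [mul_left_comm, h (n - j) ((Nat.sub_le _ _).trans hn) x, mul_sum]
    exact sum_congr rfl fun i _ => by ring
  · simp

/-- The signed maximal minors of a matrix with one more column than rows. -/
def signedMinor {m : ℕ} (D : Matrix (Fin m) (Fin (m + 1)) ℝ) (j : ℕ) : ℝ :=
  (-1) ^ j * (D.submatrix id (Fin.ofNat (m + 1) j).succAbove).det

/-- The square matrix with first row `r` followed by the rows of `D`. -/
def consRow {m : ℕ} (r : ℕ → ℝ) (D : Matrix (Fin m) (Fin (m + 1)) ℝ) :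
    Matrix (Fin (m + 1)) (Fin (m + 1)) ℝ :=
  Matrix.of fun i j => Fin.cases (r j) (fun i => D i j) i

theorem det_consRow {m : ℕ} (r : ℕ → ℝ) (D : Matrix (Fin m) (Fin (m + 1)) ℝ) :
    (consRow r D).det =
      ∑ j ∈ range (m + 1), signedMinor D j * r j := by
  rw [det_succ_row_zero, ← Fin.sum_univ_eq_sum_range (fun j => signedMinor D j * r j)]
  refine sum_congr rfl fun j _ => ?_
  have e : (consRow r D).submatrix Fin.succ j.succAbove =
      D.submatrix id j.succAbove := by
    rfl
  rw [e, signedMinor, Fin.ofNat_val_eq_self, show consRow r D 0 j = r j from rfl]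
  ring

theorem sum_signedMinor_mul_row {m : ℕ} (r : ℕ → ℝ) (D : Matrix (Fin m) (Fin (m + 1)) ℝ)
    (i : Fin m) (h : ∀ j : Fin (m + 1), D i j = r j) :
    ∑ j ∈ range (m + 1), signedMinor D j * r j = 0 := by
  rw [← det_consRow]
  refine det_zero_of_row_eq (Fin.succ_ne_zero i).symm ?_
  exact funext fun j => (h j).symm

variable {a b N : ℕ} {M : ℕ → ℝ}

/-- The rows of the matrix defining `qM` after the first one. -/
def WMatrix (a b N : ℕ) (M : ℕ → ℝ) (n : ℕ) : Matrix (Fin a) (Fin (a + 1)) ℝ :=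
  Matrix.of fun i j => W a b (N : ℝ) M (b + i) (-(n : ℝ) + ((j : ℕ) : ℝ) - 1)

theorem poch_mul_factorial (n m : ℕ) :
    poch ((n : ℝ) + 1) m * (n.factorial : ℝ) = ((n + m).factorial : ℝ) := by
  induction m with
  | zero => simp [poch_zero]
  | succ m ih =>
    rw [poch_succ, ← Nat.add_assoc, Nat.factorial_succ]
    push_cast
    rw [← ih]
    ring

theorem qM_lam {n : ℕ} (hn : n ≤ N + b) (x : ℝ) :
    qM a b N M n (lam a b x) = (-1) ^ n / ((N + b - n + a).factorial : ℝ) *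
      ∑ j ∈ range (a + 1), signedMinor (WMatrix a b N M n) j *
        (if j ≤ n then dualHahnSeq a b N (n - j) x else 0) := by
  have e : ∀ κ : ℝ, ∀ f : ℕ → ℝ, κ * ∑ j ∈ range (a + 1), signedMinor (WMatrix a b N M n) j * f j =
      ∑ j ∈ range (a + 1), signedMinor (WMatrix a b N M n) j * (κ * f j) := fun κ f => by
    rw [mul_sum]
    exact sum_congr rfl fun j _ => by ring
  rw [e, ← det_consRow, qM]
  congr 1
  ext i j
  refine Fin.cases ?_ (fun i => ?_) i
  · simp only [of_apply, Fin.val_zero, if_true, consRow, Fin.cases_zero]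
    rcases le_or_gt (j : ℕ) n with hj | hj
    · have h₁ := poch_mul_factorial (N + b - n + j) (a - j)
      have h₂ : N + b - n + j + (a - j) = N + b - n + a := by omega
      have h₃ : (((N + b - n + j : ℕ) : ℝ) + 1) = (b : ℝ) + N - n + (j : ℕ) + 1 := by
        rw [Nat.cast_add, Nat.cast_sub hn]
        push_cast
        ring
      have h₄ : N + b - (n - j) = N + b - n + j := by omega
      rw [h₂, h₃] at h₁
      have h₅ : ((N + b - n + a).factorial : ℝ) ≠ 0 := Nat.cast_ne_zero.2 (Nat.factorial_ne_zero _)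
      have h₆ : poch ((b : ℝ) + N - n + (j : ℕ) + 1) (a - j) ≠ 0 := by
        intro h
        rw [h, zero_mul] at h₁
        exact h₅ h₁.symm
      have h₇ : (-1 : ℝ) ^ n * (-1) ^ (n - j) = (-1) ^ (j : ℕ) := by
        rw [← pow_add, show n + (n - j) = 2 * (n - j) + j by omega, pow_add, pow_mul]
        simp
      rw [if_pos hj, dualHahn, if_neg (by omega), dualHahnSeq, h₄, div_mul_eq_mul_div,
        div_eq_div_iff h₆ h₅, show ((n : ℤ) - (j : ℕ)).toNat = n - j by omega, ← h₁, ← h₇]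
      ring
    · rw [if_neg (by omega), dualHahn, if_pos (by omega)]
      simp
  · simp [WMatrix, consRow]

theorem qM_zero_eq_zero (h : PhiM a b N M 0 = 0) (x : ℝ) :
    qM a b N M 0 (lam a b x) = 0 := by
  rw [qM_lam (Nat.zero_le _), sum_eq_single 0]
  · have : signedMinor (WMatrix a b N M 0) 0 = PhiM a b N M 0 := by
      rw [signedMinor, PhiM, pow_zero, one_mul]
      congr 1
      ext i j
      simp [WMatrix]
    rw [this, h]
    simp
  · intro j _ hj
    rw [if_neg (by omega), mul_zero]
  · simp

theorem exists_shiftRel_qM (hba : b ≤ a) :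
    ∃ P : ℝ[X], (∀ n : ℕ, P.eval ((n : ℝ) + 1) - P.eval (n : ℝ) = PhiM a b N M (n + 1)) ∧
      ShiftRel (N + b) (a * b + 1) (fun n x => qM a b N M n (lam a b x))
        (fun n x => P.eval (n : ℝ) * qM a b N M n (lam a b x)) := by
  have hY : ∀ h : Fin a, ∃ p : ℝ[X], p.natDegree ≤ b + h ∧
      ∀ z, p.eval z = W a b (N : ℝ) M (b + h) (-z - 1) := by
    intro h
    obtain ⟨p, hp, H⟩ := exists_polynomial_W (N := N) (M := M) hba (g := b + h) (by omega)
    refine ⟨p.comp (C (-1) * X + C (-1)), ?_, fun z => ?_⟩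
    · refine natDegree_comp_le.trans ((Nat.mul_le_mul hp natDegree_linear_le).trans ?_)
      rw [mul_one]
    · rw [eval_comp, H]
      congr 1
      simp
      ring
  choose Y hYd hYe using hY
  obtain ⟨p, hp, hpe⟩ := exists_det_casorati Y b hYd
  obtain ⟨P, hP, hPe⟩ := exists_antidifference p (a * b) hp
  have hdiff : ∀ z, P.eval (z + 1) - P.eval z = (casorati Y z).det := fun z => by rw [hPe, hpe]
  refine ⟨P, fun n => ?_, ?_⟩
  · rw [hdiff, ← det_transpose, PhiM]
    congr 1
    ext i j
    simp only [casorati, transpose_apply, of_apply, hYe]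
    congr 1
    push_cast
    ring
  · have hrel := (shiftRel_intertwined Y (shiftRel_dualHahnSeq_mul a b N)
      (shiftRel_dualHahnSeq_partialSum a b N) (casoratiKernel_mem Y b hYd) P hP).convolution
      (a + 1) (fun n => signedMinor (WMatrix a b N M n))
    obtain ⟨d, c, hd, H⟩ := hrel.mul_left (fun n => (-1) ^ n / ((N + b - n + a).factorial : ℝ))
    refine ⟨d, c, hd, fun n hn x => ?_⟩
    have hH := H n hn x
    have hz : ∀ h, ∑ j ∈ range (a + 1), signedMinor (WMatrix a b N M n) j *
        (Y h).eval ((n : ℝ) - j) = 0 := fun h =>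
      sum_signedMinor_mul_row (fun j => (Y h).eval ((n : ℝ) - j)) _ h fun j => by
        simp only [WMatrix, of_apply, hYe]
        congr 1
        ring
    simp only [sum_mul_intertwined Y hz (P := fun z => P.eval z) hdiff] at hH
    simp only [qM_lam hn]
    rw [← hH]
    ring

end Bispectral

/-- Theorem 1.1 (bispectrality): the functions `q_n^{a,b,N;𝓜}(λ^{a,b}(x))` are common
eigenfunctions of a higher order difference operator `∑_{j=-r}^{r} h_j 𝔖_j^λ` with
rational coefficients, where `r = ab + 1`. -/
theorem duran_thm1_1_bispectral (a b N : ℕ) (M : ℕ → ℝ)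
    (hb : 1 ≤ b) (hba : b ≤ a) (haN : a ≤ N)
    (hM : ∀ i, i < b → M i ≠ 0 ∧ M i ≠ 1) :
    ∃ (num den : ℤ → Polynomial ℝ) (γ : ℕ → ℝ),
      (∀ j ∈ Finset.Icc (-(((a * b : ℕ) : ℤ) + 1)) (((a * b : ℕ) : ℤ) + 1), den j ≠ 0) ∧
      (∃ n m, n ≤ N + b ∧ m ≤ N + b ∧ γ n ≠ γ m) ∧
      (∀ n, n ≤ N + b → ∀ x : ℝ,
        (∀ j ∈ Finset.Icc (-(((a * b : ℕ) : ℤ) + 1)) (((a * b : ℕ) : ℤ) + 1),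
          (den j).eval x ≠ 0) →
        ∑ j ∈ Finset.Icc (-(((a * b : ℕ) : ℤ) + 1)) (((a * b : ℕ) : ℤ) + 1),
          (num j).eval x / (den j).eval x * qM a b N M n (lam a b (x + (j : ℝ))) =
          γ n * qM a b N M n (lam a b x)) := by
  by_cases h : PhiM a b N M 0 = 0
  · refine ⟨fun _ => 0, fun _ => 1, fun n => if n = 0 then 1 else 0, fun _ _ => one_ne_zero,
      ⟨0, 1, Nat.zero_le _, by omega, by simp⟩, fun n _ x _ => ?_⟩
    rcases eq_or_ne n 0 with rfl | hn
    · rw [qM_zero_eq_zero h]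
      simp
    · simp [hn]
  · obtain ⟨P, hP, d, c, hd, H⟩ := exists_shiftRel_qM (N := N) (M := M) hba
    obtain ⟨k, hk, hkN, hΦ⟩ := exists_PhiM_ne_zero hba (by omega) (by omega) h
    refine ⟨c, fun _ => d, fun n => P.eval (n : ℝ), fun _ _ => hd,
      ⟨k, k - 1, hkN, by omega, fun heq => hΦ ?_⟩, fun n hn x hx => ?_⟩
    · obtain ⟨l, rfl⟩ := Nat.exists_eq_add_of_le' hk
      rw [← hP l, sub_eq_zero]
      simpa using heq
    · have hdx : d.eval x ≠ 0 := hx 0 (Finset.mem_Icc.2 ⟨by omega, by omega⟩)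
      have hH := H n hn x
      rw [show ((a * b + 1 : ℕ) : ℤ) = ((a * b : ℕ) : ℤ) + 1 from Nat.cast_succ _] at hH
      refine mul_left_cancel₀ hdx (Eq.trans ?_ hH.symm)
      rw [Finset.mul_sum]
      refine Finset.sum_congr rfl fun j _ => ?_
      field_simp
end
end

section
/- All N+b+1 masses of the measure ν_{a,b,N}^{M} are strictly positive if and only if M_i > 0 for every i = 0,…,b−1. In particular, the masses at the points λ^{a,b}(x) for x = 0,…,N are strictly positive regardless of the values of M_0,…,M_{b−1}. -/
noncomputable section

open Finset

theorem poch_pos {x : ℝ} (hx : 0 < x) (m : ℕ) : 0 < poch x m :=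
  Finset.prod_pos fun _ _ => by positivity

theorem poch_neg (x : ℝ) (m : ℕ) :
    poch (-x) m = (-1) ^ m * ∏ i ∈ Finset.range m, (x - i) := by
  have h : ∀ i ∈ Finset.range m, -x + (i : ℝ) = -1 * (x - i) := fun i _ => by ring
  rw [poch, Finset.prod_congr rfl h, Finset.prod_mul_distrib, Finset.prod_const,
    Finset.card_range]

theorem rhoDH_pos (a b : ℕ) {N x : ℕ} (hx : x ≤ N) : 0 < rhoDH a b N x := by
  have h1 : 0 < ∏ i ∈ Finset.range x, ((N : ℝ) - i) := by
    refine Finset.prod_pos fun i hi => sub_pos.2 ?_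
    exact_mod_cast (Finset.mem_range.1 hi).trans_le hx
  have h2 : 0 < poch ((b : ℝ) + 1) x := poch_pos (by positivity) _
  have h3 : 0 < poch ((a : ℝ) + 1) x := poch_pos (by positivity) _
  have h4 : 0 < poch ((x : ℝ) + a + b + 1) (N + 1) := poch_pos (by positivity) _
  have h : rhoDH a b N x =
      (2 * (x : ℝ) + a + b + 1) * poch ((b : ℝ) + 1) x *
          (∏ i ∈ Finset.range x, ((N : ℝ) - i)) * (Nat.factorial N : ℝ) /
        (poch ((x : ℝ) + a + b + 1) (N + 1) * poch ((a : ℝ) + 1) x *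
          (Nat.factorial x : ℝ)) := by
    rw [rhoDH, poch_neg]
    conv_rhs => rw [← mul_div_mul_left _ _ (pow_ne_zero x (neg_ne_zero.2 one_ne_zero))]
    congr 1 <;> ring
  rw [h]
  positivity

theorem mass_pos_of_nonneg (a b : ℕ) {N : ℕ} (M : ℕ → ℝ) {x : ℤ} (hx : 0 ≤ x) (hxN : x ≤ N) :
    0 < mass a b N M x := by
  rw [mass, if_neg hx.not_gt]
  have hx' : (0 : ℝ) ≤ x := by exact_mod_cast hx
  have h1 : 0 < poch ((N : ℝ) + 1) b := poch_pos (by positivity) _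
  have h2 : 0 < poch ((b : ℝ) + 1) (a - b) := poch_pos (by positivity) _
  have h3 : 0 < rhoDH a b N x.toNat := rhoDH_pos a b (by omega)
  have h4 : 0 < ∏ i ∈ Finset.range b, (((x : ℝ) + a + i + 1) * ((x : ℝ) + b - i)) := by
    refine Finset.prod_pos fun i hi => mul_pos (by positivity) ?_
    have : (i : ℝ) < b := by exact_mod_cast Finset.mem_range.1 hi
    linarith
  positivity

theorem mass_pos_iff_of_neg {a b : ℕ} (N : ℕ) (M : ℕ → ℝ) (hba : b ≤ a) {x : ℤ}
    (hbx : -(b : ℤ) ≤ x) (hx : x < 0) :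
    0 < mass a b N M x ↔ 0 < M (x + b).toNat := by
  rw [mass, if_pos hx]
  have hx' : (x : ℝ) < 0 := by exact_mod_cast hx
  have hbx' : -(b : ℝ) ≤ x := by exact_mod_cast hbx
  have hba' : (b : ℝ) ≤ a := by exact_mod_cast hba
  have hN : (0 : ℝ) ≤ N := N.cast_nonneg
  refine mul_pos_iff_of_pos_left (div_pos (mul_pos ?_ (poch_pos ?_ _)) (poch_pos ?_ _))
  · linarith
  · linarith
  · positivity

/-- The measure `ν_{a,b,N}^{𝓜}` is positive if and only if all the parameters `M_i` are
positive; the masses at `λ^{a,b}(x)` for `x = 0,…,N` are always positive. -/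
theorem duran_positivity (a b N : ℕ) (M : ℕ → ℝ)
    (hb : 1 ≤ b) (hba : b ≤ a) (haN : a ≤ N)
    (hM : ∀ i, i < b → M i ≠ 0 ∧ M i ≠ 1) :
    ((∀ x : ℤ, -(b : ℤ) ≤ x → x ≤ N → 0 < mass a b N M x) ↔
      (∀ i, i < b → 0 < M i)) ∧
    (∀ x : ℤ, 0 ≤ x → x ≤ N → 0 < mass a b N M x) := by
  refine ⟨⟨fun h i hi => ?_, fun h x hbx hxN => ?_⟩, fun x => mass_pos_of_nonneg a b M⟩
  · have hi' := (mass_pos_iff_of_neg N M hba (x := (i : ℤ) - b) (by omega) (by omega)).1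
      (h _ (by omega) (by omega))
    simpa using hi'
  · rcases lt_or_ge x 0 with hx | hx
    · exact (mass_pos_iff_of_neg N M hba hbx hx).2 (h _ (by omega))
    · exact mass_pos_of_nonneg a b M hx hxN
end
end
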